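/- arXiv:1909.07905 — 2 statements merged into one kernel-verified Lean document; each statement's English description precedes it below -/
import Mathlib

section
/- An origin-symmetric convex body K in ℝ² admits a B-measure on its boundary if and only if the set A(K) \ E(K) is uncountable. -/
open Set MeasureTheory Pointwise

abbrev Plane := ℝ × ℝ

/-- An origin-symmetric convex body in the plane: compact, convex,
nonempty interior, symmetric about the origin. -/
def IsSymmConvexBody (K : Set Plane) : Prop :=
  Convex ℝ K ∧ IsCompact K ∧ (interior K).Nonempty ∧ K = -K

/-- Birkhoff orthogonality with respect to the norm induced by `K`
(whose Minkowski functional is `gauge K`). -/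
def BOrth (K : Set Plane) (x y : Plane) : Prop :=
  ∀ t : ℝ, gauge K x ≤ gauge K (x + t • y)

/-- The set of Auerbach points of `K`. -/
def Auerbach (K : Set Plane) : Set Plane :=
  {x | x ∈ frontier K ∧ ∃ y ∈ frontier K, BOrth K x y ∧ BOrth K y x}

/-- `E(K)`: the union of the open non-degenerate segments contained in `∂K`. -/
def SegUnion (K : Set Plane) : Set Plane :=
  {x | ∃ a b : Plane, a ≠ b ∧ segment ℝ a b ⊆ frontier K ∧ x ∈ openSegment ℝ a b}

/-- A closed antipode-free arc of `∂K` with endpoints `x` and `y`: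
a closed connected subset of `∂K` containing `x` and `y`, containing no
pair of antipodal points, and minimal with these properties. -/
def IsBArc (K C : Set Plane) (x y : Plane) : Prop :=
  C ⊆ frontier K ∧ IsClosed C ∧ IsPreconnected C ∧ x ∈ C ∧ y ∈ C ∧
  (∀ z ∈ C, -z ∉ C) ∧
  ∀ C' ⊆ C, IsClosed C' → IsPreconnected C' → x ∈ C' → y ∈ C' → C' = C

/-- An angular measure on `∂K`. -/
def IsAngularMeasure (K : Set Plane) (μ : Measure Plane) : Prop :=
  μ (frontier K) = ENNReal.ofReal (2 * Real.pi) ∧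
  μ (frontier K)ᶜ = 0 ∧
  (∀ X : Set Plane, μ (-X) = μ X) ∧
  (∀ x : Plane, μ {x} = 0)

/-- A B-measure: an angular measure giving `π/2` to every closed
antipode-free arc whose endpoints are Birkhoff orthogonal. -/
def IsBMeasure (K : Set Plane) (μ : Measure Plane) : Prop :=
  IsAngularMeasure K μ ∧
  ∀ C x y, IsBArc K C x y → BOrth K x y → μ C = ENNReal.ofReal (Real.pi / 2)

/-- The support of a Borel measure: the points all of whose open
neighborhoods have positive measure. -/
def msupp {α : Type*} [TopologicalSpace α] [MeasurableSpace α]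
    (μ : Measure α) : Set α :=
  {x | ∀ U : Set α, IsOpen U → x ∈ U → 0 < μ U}


/-- abstract Auerbach parameters off the segments -/
def absB (R : ℝ → ℝ → Prop) : Set ℝ :=
  {s | (∃ t, R s t ∧ R t (s + Real.pi)) ∧ ¬ ∃ s₁ s₂ t, s₁ < s ∧ s < s₂ ∧ R s₁ t ∧ R s₂ t}

lemma shift_int (F : ℝ → ℝ) (hp : ∀ x, F (x + Real.pi) = F x + Real.pi) (x : ℝ) (n : ℤ) :
    F (x + n * Real.pi) = F x + n * Real.pi := by
  induction n using Int.induction_on with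
  | zero => simp
  | succ k ih =>
    have := hp (x + k * Real.pi)
    push_cast at *
    rw [add_mul, ← add_assoc, one_mul, this, ih]; ring
  | pred k ih =>
    have := hp (x + (-k - 1) * Real.pi)
    push_cast at *
    have e : x + (-(k:ℝ) - 1) * Real.pi + Real.pi = x + -k * Real.pi := by ring
    rw [e, ih] at this; linarith

lemma shift_surj (F : ℝ → ℝ) (hp : ∀ x, F (x + Real.pi) = F x + Real.pi) (hc : Continuous F) :
    Function.Surjective F := by
  intro c
  have hpi := Real.pi_pos
  refine mem_range_of_exists_le_of_exists_ge hc ?_ ?_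
  · refine ⟨0 + (⌊(c - F 0) / Real.pi⌋ : ℤ) * Real.pi, ?_⟩
    rw [shift_int F hp]
    have := Int.floor_le ((c - F 0) / Real.pi)
    rw [le_div_iff₀ hpi] at this; linarith
  · refine ⟨0 + (⌈(c - F 0) / Real.pi⌉ : ℤ) * Real.pi, ?_⟩
    rw [shift_int F hp]
    have := Int.le_ceil ((c - F 0) / Real.pi)
    rw [div_le_iff₀ hpi] at this; linarith

lemma abs_fwd (R : ℝ → ℝ → Prop) (htot : ∀ s, ∃ t, R s t) (F : ℝ → ℝ) (hm : Monotone F)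
    (hc : Continuous F) (hp : ∀ x, F (x + Real.pi) = F x + Real.pi)
    (hR : ∀ s t, R s t → F t = F s + Real.pi / 2) : ¬ (absB R).Countable := by
  intro hB
  have key : (univ : Set ℝ) ⊆ F '' (absB R) ∪ range (fun q : ℚ => F q) := by
    intro c _
    obtain ⟨s, rfl⟩ := shift_surj F hp hc c
    by_cases hs : s ∈ absB R
    · exact Or.inl ⟨s, hs, rfl⟩
    right
    have flat : ∃ z, z ≠ s ∧ F z = F s := by
      by_cases hE : ∃ s₁ s₂ t, s₁ < s ∧ s < s₂ ∧ R s₁ t ∧ R s₂ t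
      · obtain ⟨s₁, s₂, t, h1, h2, r1, r2⟩ := hE
        refine ⟨s₁, h1.ne, ?_⟩
        have a1 := hR _ _ r1
        have a2 := hR _ _ r2
        have := hm h1.le
        have := hm h2.le
        linarith
      · obtain ⟨t, ht⟩ := htot s
        obtain ⟨z, hz⟩ := htot t
        refine ⟨z - Real.pi, ?_, ?_⟩
        · intro h
          apply hs
          refine ⟨⟨t, ht, ?_⟩, hE⟩
          rw [← h]; simpa using hz
        · have a1 := hR _ _ ht
          have a2 := hR _ _ hz
          have := hp (z - Real.pi)
          simp only [sub_add_cancel] at this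
          linarith
    obtain ⟨z, hz, hF⟩ := flat
    rcases lt_or_gt_of_ne hz with h | h
    · obtain ⟨q, h1, h2⟩ := exists_rat_btwn h
      refine ⟨q, le_antisymm (hm h2.le) ?_⟩
      show F s ≤ F q
      rw [← hF]; exact hm h1.le
    · obtain ⟨q, h1, h2⟩ := exists_rat_btwn h
      refine ⟨q, le_antisymm ?_ (hm h1.le)⟩
      show F q ≤ F s
      rw [← hF]; exact hm h2.le
  exact Cardinal.not_countable_real (((hB.image F).union (countable_range _)).mono key)

lemma three_pts (G : ℝ → ℝ) (hc : Continuous G) (B : Set ℝ)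
    (hG : ∀ c d, c < d → (∀ x ∈ B, ¬ (c < x ∧ x < d)) → G c = G d) (hm : Monotone G)
    (c d : ℝ) (hcd : c < d) (hne : G c ≠ G d) :
    ∃ v₁ ∈ B, ∃ v₂ ∈ B, ∃ v₃ ∈ B, c < v₁ ∧ v₁ < v₂ ∧ v₂ < v₃ ∧ v₃ < d := by
  have hlt : G c < G d := lt_of_le_of_ne (hm hcd.le) hne
  have ivt := intermediate_value_Icc hcd.le hc.continuousOn
  obtain ⟨x₁, -, h1⟩ := ivt (show (2 * G c + G d) / 3 ∈ Icc (G c) (G d) by constructor <;> linarith)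
  obtain ⟨x₂, -, h2⟩ := ivt (show (G c + 2 * G d) / 3 ∈ Icc (G c) (G d) by constructor <;> linarith)
  have get : ∀ a b, G a < G b → ∃ v ∈ B, a < v ∧ v < b := by
    intro a b hab
    by_contra hcon
    push Not at hcon
    have := hG a b (hm.reflect_lt hab) (fun x hx h => absurd h.2 (not_lt.2 (hcon x hx h.1)))
    exact hab.ne this
  obtain ⟨v₁, b1, l1, r1⟩ := get c x₁ (by linarith)
  obtain ⟨v₂, b2, l2, r2⟩ := get x₁ x₂ (by linarith)
  obtain ⟨v₃, b3, l3, r3⟩ := get x₂ d (by linarith)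
  exact ⟨v₁, b1, v₂, b2, v₃, b3, l1, r1.trans l2, r2.trans l3, r3⟩

lemma abs_bwd (R : ℝ → ℝ → Prop) (htot : ∀ s, ∃ t, R s t) (htot' : ∀ t, ∃ s, R s t)
    (hmono : ∀ s t s' t', s < s' → R s t → R s' t' → t ≤ t')
    (hsh : ∀ s t, R s t ↔ R (s + Real.pi) (t + Real.pi))
    (G : ℝ → ℝ) (hm : Monotone G) (hc : Continuous G)
    (hp : ∀ x, G (x + Real.pi) = G x + Real.pi)
    (hG : ∀ c d, c < d → (∀ x ∈ absB R, ¬ (c < x ∧ x < d)) → G c = G d) :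
    ∃ F : ℝ → ℝ, Monotone F ∧ Continuous F ∧ (∀ x, F (x + Real.pi) = F x + Real.pi) ∧
      ∀ s t, R s t → F t = F s + Real.pi / 2 := by
  have hmono' : ∀ s t s' t', t < t' → R s t → R s' t' → s ≤ s' := by
    intro s t s' t' h r r'
    by_contra hh
    exact absurd (hmono _ _ _ _ (not_le.1 hh) r' r) (not_le.2 h)
  -- `G` is constant on every `R s`
  have const : ∀ s c d, c < d → R s c → R s d → G c = G d := by
    intro s c d hcd rc rd
    by_contra hne
    obtain ⟨v₁, b1, v₂, b2, v₃, b3, h1, h2, h3, h4⟩ := three_pts G hc _ hG hm c d hcd hne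
    have q : ∀ v ∈ absB R, c < v → v < d → R v (s + Real.pi) := by
      intro v hv hcv hvd
      obtain ⟨⟨u, r1, r2⟩, -⟩ := hv
      have r3 : R (u - Real.pi) v := by rw [hsh]; simpa using r2
      have e1 := hmono' _ _ _ _ hcv rc r3
      have e2 := hmono' _ _ _ _ hvd r3 rd
      have : u = s + Real.pi := by linarith
      rwa [← this]
    exact b2.2 ⟨v₁, v₃, _, h2, h3, q v₁ b1 h1 (by linarith), q v₃ b3 (by linarith) h4⟩
  have const' : ∀ s c d, R s c → R s d → G c = G d := by
    intro s c d rc rd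
    rcases lt_trichotomy c d with h | h | h
    · exact const s c d h rc rd
    · rw [h]
    · exact (const s d c h rd rc).symm
  have two : ∀ s t z, R s t → R t z → G z = G s + Real.pi := by
    intro s t z r1 r2
    have : G (z - Real.pi) = G s := by
      rcases lt_trichotomy s (z - Real.pi) with h | h | h
      · by_contra hne
        obtain ⟨v₁, b1, v₂, b2, v₃, b3, h1, h2, h3, h4⟩ :=
          three_pts G hc _ hG hm _ _ h (Ne.symm hne)
        have q : ∀ u ∈ absB R, s < u → u < z - Real.pi → R u t := by
          intro u hu l1 l2
          obtain ⟨⟨v, s1, s2⟩, -⟩ := hu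
          have e1 := hmono _ _ _ _ l1 r1 s1
          have e2 := hmono' _ _ _ _ (show u + Real.pi < z by linarith) s2 r2
          rwa [le_antisymm e1 e2]
        exact b2.2 ⟨v₁, v₃, _, h2, h3, q v₁ b1 h1 (by linarith), q v₃ b3 (by linarith) h4⟩
      · rw [h]
      · by_contra hne
        obtain ⟨v₁, b1, v₂, b2, v₃, b3, h1, h2, h3, h4⟩ :=
          three_pts G hc _ hG hm _ _ h hne
        have q : ∀ u ∈ absB R, z - Real.pi < u → u < s → R u t := by
          intro u hu l1 l2
          obtain ⟨⟨v, s1, s2⟩, -⟩ := hu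
          have e1 := hmono _ _ _ _ l2 s1 r1
          have e2 := hmono' _ _ _ _ (show z < u + Real.pi by linarith) r2 s2
          rwa [← le_antisymm e1 e2]
        exact b2.2 ⟨v₁, v₃, _, h2, h3, q v₁ b1 h1 (by linarith), q v₃ b3 (by linarith) h4⟩
    have h2 := hp (z - Real.pi)
    rw [sub_add_cancel] at h2
    rw [h2, this]
  choose r hr using htot
  have Hm : Monotone (fun s => G (r s)) := by
    intro s s' h
    rcases h.lt_or_eq with h | h
    · exact hm (hmono _ _ _ _ h (hr s) (hr s'))
    · rw [h]
  have Hs : Function.Surjective (fun s => G (r s)) := by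
    intro c
    obtain ⟨t, rfl⟩ := shift_surj G hp hc c
    obtain ⟨s, hs⟩ := htot' t
    exact ⟨s, const' _ _ _ (hr s) hs⟩
  have Hc : Continuous (fun s => G (r s)) := Hm.continuous_of_surjective Hs
  refine ⟨fun s => (G s + G (r s)) / 2, ?_, ?_, ?_, ?_⟩
  · intro a b h
    have := hm h
    have := Hm h
    simp only at *
    linarith
  · exact (hc.add Hc).div_const 2
  · intro x
    have h1 : G (r (x + Real.pi)) = G (r x + Real.pi) :=
      const' _ _ _ (hr _) ((hsh _ _).1 (hr x))
    simp only [h1, hp]; ring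
  · intro s t h
    have h1 := const' _ _ _ (hr s) h
    have h2 := two _ _ _ h (hr t)
    simp only [h1, h2]; ring

/-- periodization of a function on `[0, π]` -/
noncomputable def periodize (m : ℝ → ℝ) (x : ℝ) : ℝ :=
  m (Real.pi * Int.fract (x / Real.pi)) + ⌊x / Real.pi⌋ * Real.pi

lemma periodize_eq (m : ℝ → ℝ) (h0 : m 0 = 0) (h1 : m Real.pi = Real.pi) (n : ℤ) (x : ℝ)
    (hx : n * Real.pi ≤ x) (hx' : x ≤ (n + 1) * Real.pi) :
    periodize m x = m (x - n * Real.pi) + n * Real.pi := by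
  have hpi := Real.pi_pos
  unfold periodize
  rcases hx'.lt_or_eq with h | h
  · have : ⌊x / Real.pi⌋ = n := by
      rw [Int.floor_eq_iff, le_div_iff₀ hpi, div_lt_iff₀ hpi]
      exact ⟨hx, h⟩
    rw [Int.fract, this]
    congr 2
    field_simp
  · have : x / Real.pi = ((n + 1 : ℤ) : ℝ) := by rw [h]; push_cast; field_simp
    rw [this, Int.fract_intCast, Int.floor_intCast, h, mul_zero, h0]
    have : ((n:ℝ) + 1) * Real.pi - n * Real.pi = Real.pi := by ring
    rw [this, h1]; push_cast; ring

lemma periodize_shift (m : ℝ → ℝ) (x : ℝ) :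
    periodize m (x + Real.pi) = periodize m x + Real.pi := by
  have hpi := Real.pi_pos
  unfold periodize
  have : (x + Real.pi) / Real.pi = x / Real.pi + 1 := by field_simp
  rw [this, Int.fract_add_one, Int.floor_add_one]
  push_cast; ring

lemma exists_cell (x : ℝ) : ∃ n : ℤ, n * Real.pi ≤ x ∧ x < (n + 1) * Real.pi := by
  have hpi := Real.pi_pos
  refine ⟨⌊x / Real.pi⌋, ?_, ?_⟩
  · have := Int.floor_le (x / Real.pi)
    rwa [le_div_iff₀ hpi] at this
  · have := Int.lt_floor_add_one (x / Real.pi)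
    rwa [div_lt_iff₀ hpi] at this

lemma periodize_mono (m : ℝ → ℝ) (h0 : m 0 = 0) (h1 : m Real.pi = Real.pi)
    (hm : MonotoneOn m (Icc 0 Real.pi)) : Monotone (periodize m) := by
  have hpi := Real.pi_pos
  intro x y hxy
  obtain ⟨a, a1, a2⟩ := exists_cell x
  obtain ⟨b, b1, b2⟩ := exists_cell y
  rw [periodize_eq m h0 h1 a x a1 a2.le, periodize_eq m h0 h1 b y b1 b2.le]
  have hab : a < b + 1 := by
    have : (a:ℝ) * Real.pi < (b + 1) * Real.pi := by linarith
    exact_mod_cast lt_of_mul_lt_mul_right this hpi.le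
  rcases (Int.lt_add_one_iff.1 hab).lt_or_eq with h | h
  · have c1 : m (x - a * Real.pi) ≤ m Real.pi :=
      hm ⟨by linarith, by linarith⟩ ⟨hpi.le, le_rfl⟩ (by linarith)
    have c2 : m 0 ≤ m (y - b * Real.pi) :=
      hm ⟨le_rfl, hpi.le⟩ ⟨by linarith, by linarith⟩ (by linarith)
    have : ((a:ℝ) + 1) * Real.pi ≤ b * Real.pi := by
      apply mul_le_mul_of_nonneg_right _ hpi.le
      exact_mod_cast h
    linarith
  · subst h
    have := hm (a := x - a * Real.pi) (b := y - a * Real.pi) ⟨by linarith, by linarith⟩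
      ⟨by linarith, by linarith⟩ (by linarith)
    linarith

lemma periodize_cont (m : ℝ → ℝ) (h0 : m 0 = 0) (h1 : m Real.pi = Real.pi)
    (hm : ContinuousOn m (Icc 0 Real.pi)) : Continuous (periodize m) := by
  have hpi := Real.pi_pos
  have e : periodize m = fun x => (fun u => m (Real.pi * u) - Real.pi * u)
      (Int.fract (x / Real.pi)) + x := by
    funext x
    have : x = Real.pi * (Int.fract (x / Real.pi) + ⌊x / Real.pi⌋) := by
      rw [Int.fract_add_floor]; field_simp
    unfold periodize
    simp only
    nth_rewrite 5 [this]
    ring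
  rw [e]
  refine Continuous.add ?_ continuous_id
  have hc : ContinuousOn (fun u => m (Real.pi * u) - Real.pi * u) (Icc 0 1) := by
    refine ContinuousOn.sub (hm.comp (by fun_prop) ?_) (by fun_prop)
    intro u hu
    exact ⟨by have := hu.1; positivity, by nlinarith [hu.2]⟩
  have := ContinuousOn.comp_fract'' (f := fun u => m (Real.pi * u) - Real.pi * u) hc
    (by simp [h0, h1])
  exact this.comp (by fun_prop : Continuous fun x : ℝ => x / Real.pi)

section meas
variable {X : Type*} [MetricSpace X] [MeasurableSpace X] [BorelSpace X]

/-- mass of initial arcs -/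
noncomputable def arcMass (μ : Measure X) (p : ℝ → X) (u : ℝ) : ℝ := μ.real (p '' Icc 0 u)

lemma arcMass_mono (μ : Measure X) [IsFiniteMeasure μ] (p : ℝ → X) : Monotone (arcMass μ p) := by
  intro a b h
  exact measureReal_mono (image_mono (Icc_subset_Icc_right h))

lemma arcMass_le (μ : Measure X) [IsFiniteMeasure μ] (p : ℝ → X) (u v : ℝ) :
    arcMass μ p v ≤ arcMass μ p u + μ.real (p '' Icc u v) := by
  refine le_trans (measureReal_mono ?_) (measureReal_union_le _ _)
  rw [← image_union]
  apply image_mono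
  intro x hx
  rcases le_total x u with h | h
  · exact Or.inl ⟨hx.1, h⟩
  · exact Or.inr ⟨h, hx.2⟩

lemma arcMass_cont (μ : Measure X) [IsFiniteMeasure μ] (p : ℝ → X) (hp : Continuous p)
    (h0 : ∀ x, μ {x} = 0) : Continuous (arcMass μ p) := by
  rw [continuous_iff_continuousAt]
  intro u
  rw [Metric.continuousAt_iff]
  intro ε hε
  obtain ⟨U, hU, hUo, hUm⟩ := Set.exists_isOpen_lt_of_lt {p u} (ENNReal.ofReal ε)
    (by rw [h0]; simpa using hε)
  have hU' : μ.real U < ε := by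
    rw [Measure.real, ← ENNReal.lt_ofReal_iff_toReal_lt (measure_ne_top _ _)]; exact hUm
  obtain ⟨δ, hδ, hb⟩ := Metric.isOpen_iff.1 (hUo.preimage hp) u (hU rfl)
  refine ⟨δ, hδ, ?_⟩
  intro v hv
  rw [Real.dist_eq, abs_lt] at hv
  have sub : ∀ a b, u - δ < a → b < u + δ → μ.real (p '' Icc a b) < ε := by
    intro a b ha hb'
    refine lt_of_le_of_lt (measureReal_mono ?_) hU'
    rintro _ ⟨x, hx, rfl⟩
    apply hb
    rw [Metric.mem_ball, Real.dist_eq, abs_lt]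
    constructor <;> linarith [hx.1, hx.2]
  rw [Real.dist_eq, abs_lt]
  have m := arcMass_mono μ p
  rcases le_total u v with h | h
  · have := arcMass_le μ p u v
    have := sub u v (by linarith) (by linarith)
    have := m h
    constructor <;> linarith
  · have := arcMass_le μ p v u
    have := sub v u (by linarith) (by linarith)
    have := m h
    constructor <;> linarith
end meas

lemma exists_G (B : Set ℝ) (hper : ∀ x, x ∈ B ↔ x + Real.pi ∈ B) (hB : ¬ B.Countable) :
    ∃ G : ℝ → ℝ, Monotone G ∧ Continuous G ∧ (∀ x, G (x + Real.pi) = G x + Real.pi) ∧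
      ∀ c d, c < d → (∀ x ∈ B, ¬ (c < x ∧ x < d)) → G c = G d := by
  have hpi := Real.pi_pos
  have hpern : ∀ (n : ℤ) x, x ∈ B ↔ x + n * Real.pi ∈ B := by
    intro n
    induction n using Int.induction_on with
    | zero => simp
    | succ k ih => 
      intro x
      rw [ih, hper]; push_cast; ring_nf
    | pred k ih =>
      intro x
      rw [hper (x + ((-(k:ℤ) - 1 : ℤ) : ℝ) * Real.pi), ih]; push_cast; ring_nf
  set C : Set ℝ := closure B ∩ Icc 0 Real.pi with hC
  have hCu : ¬ C.Countable := by
    intro hc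
    apply hB
    have : B ⊆ ⋃ n : ℤ, (fun x => x + n * Real.pi) '' C := by
      intro x hx
      obtain ⟨n, h1, h2⟩ := exists_cell x
      rw [mem_iUnion]
      refine ⟨n, x - n * Real.pi, ⟨subset_closure ?_, by linarith, by linarith⟩, by simp⟩
      rw [hpern n]; simpa using hx
    exact (countable_iUnion fun n => hc.image _).mono this
  have hCm : MeasurableSet C := isClosed_closure.measurableSet.inter measurableSet_Icc
  have : StandardBorelSpace C := hCm.standardBorel
  have hCu' : ¬ Countable C := hCu
  let e : ℝ ≃ᵐ C := PolishSpace.measurableEquivOfNotCountable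
    (fun h => Cardinal.not_countable_real (countable_univ_iff.2 h)) hCu'
  have hem : Measurable (fun x => (e x : ℝ)) := measurable_subtype_coe.comp e.measurable
  have hei : Function.Injective (fun x => (e x : ℝ)) :=
    Subtype.val_injective.comp e.injective
  let ν : Measure ℝ := Measure.map (fun x => (e x : ℝ)) (volume.restrict (Icc 0 Real.pi))
  have : IsFiniteMeasure ν := by
    constructor
    rw [Measure.map_apply hem MeasurableSet.univ]
    simp
  have ν0 : ∀ x, ν {x} = 0 := by
    intro x
    rw [Measure.map_apply hem (measurableSet_singleton x)]
    exact Set.Subsingleton.measure_zero (subsingleton_singleton.preimage hei) _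
  have νC : ∀ S : Set ℝ, MeasurableSet S → Disjoint S C → ν S = 0 := by
    intro S hS hd
    rw [Measure.map_apply hem hS]
    have : (fun x => (e x : ℝ)) ⁻¹' S = ∅ := by
      ext x
      simp only [mem_preimage, mem_empty_iff_false, iff_false]
      intro h
      exact disjoint_left.1 hd h (e x).2
    rw [this, measure_empty]
  let m := arcMass ν id
  have mm : Monotone m := arcMass_mono ν id
  have mc : Continuous m := arcMass_cont ν id continuous_id ν0
  have m0 : m 0 = 0 := by
    simp [m, arcMass, Measure.real, ν0]
  have m1 : m Real.pi = Real.pi := by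
    simp only [m, arcMass, Measure.real, image_id]
    rw [Measure.map_apply hem measurableSet_Icc]
    have : (fun x => (e x : ℝ)) ⁻¹' Icc 0 Real.pi = univ := by
      ext x
      simp only [mem_preimage, mem_univ, iff_true]
      exact (e x).2.2
    rw [this]
    simp [hpi.le]
  have mloc : ∀ c d : ℝ, c ≤ d → (∀ x ∈ B, ¬ (c < x ∧ x < d)) → m c = m d := by
    intro c d hcd h
    refine le_antisymm (mm hcd) ?_
    refine (arcMass_le ν id c d).trans ?_
    have h1 : ν (Ioo c d) = 0 := by
      apply νC _ measurableSet_Ioo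
      have : Disjoint (Ioo c d) (closure B) := by
        rw [disjoint_left]
        intro x hx hx'
        obtain ⟨y, hy, hyB⟩ := mem_closure_iff.1 hx' _ isOpen_Ioo hx
        exact h y hyB hy
      exact this.mono_right inter_subset_left
    have h2 : ν (Icc c d) = 0 := by
      refine measure_mono_null (t := Ioo c d ∪ ({c} ∪ {d})) ?_ ?_
      · intro x hx
        rcases hx.1.eq_or_lt with h | h
        · right; left; exact h.symm
        rcases hx.2.eq_or_lt with h' | h'
        · right; right; exact h'
        exact Or.inl ⟨h, h'⟩
      · rw [measure_union_null_iff, measure_union_null_iff]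
        exact ⟨h1, ν0 _, ν0 _⟩
    simp [Measure.real, h2, m]
  have cell : ∀ (n : ℤ) (c d : ℝ), c ≤ d → n * Real.pi ≤ c → d ≤ (n + 1) * Real.pi →
      (∀ x ∈ B, ¬ (c < x ∧ x < d)) → periodize m c = periodize m d := by
    intro n c d hcd h1 h2 hB'
    rw [periodize_eq m m0 m1 n c h1 (by linarith), periodize_eq m m0 m1 n d (by linarith) h2]
    congr 1
    apply mloc _ _ (by linarith)
    intro x hx hxx
    exact hB' (x + n * Real.pi) ((hpern n x).1 hx) ⟨by linarith, by linarith⟩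
  have hperm := periodize_shift m
  refine ⟨periodize m, periodize_mono m m0 m1 (mm.monotoneOn _),
    periodize_cont m m0 m1 mc.continuousOn, hperm, ?_⟩
  intro c d hcd hB'
  obtain ⟨a, a1, a2⟩ := exists_cell c
  rcases le_total d ((a + 1) * Real.pi) with h | h
  · exact cell a c d hcd.le a1 h hB'
  have e1 : periodize m c = periodize m ((a + 1) * Real.pi) :=
    cell a _ _ a2.le a1 le_rfl (fun x hx hxx => hB' x hx ⟨hxx.1, by linarith⟩)
  rcases le_total d ((a + 1 + 1) * Real.pi) with h' | h'
  · rw [e1]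
    exact cell (a + 1) _ _ h (by push_cast; linarith) (by push_cast; linarith)
      (fun x hx hxx => hB' x hx ⟨by linarith, hxx.2⟩)
  · have := cell (a + 1) ((a + 1) * Real.pi) ((a + 1) * Real.pi + Real.pi) (by linarith)
      (by push_cast; linarith) (by push_cast; linarith)
      (fun x hx hxx => hB' x hx ⟨by linarith, by linarith⟩)
    rw [hperm] at this
    linarith
lemma nhds0 {K : Set Plane} (hK : IsSymmConvexBody K) : K ∈ nhds (0 : Plane) := by
  obtain ⟨hc, -, ⟨x, hx⟩, hs⟩ := hK
  have hx' : -x ∈ interior K := by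
    have : -x ∈ -interior K := by simpa using hx
    have e : -interior K = interior (-K) := (Homeomorph.neg Plane).preimage_interior K
    rwa [e, ← hs] at this
  have := hc.interior hx hx' (a := 1/2) (b := 1/2) (by norm_num) (by norm_num) (by norm_num)
  rw [smul_neg, add_neg_cancel] at this
  exact mem_interior_iff_mem_nhds.1 this

lemma g_add {K : Set Plane} (hK : IsSymmConvexBody K) (x y : Plane) :
    gauge K (x + y) ≤ gauge K x + gauge K y :=
  gauge_add_le hK.1 (absorbent_nhds_zero (nhds0 hK)) x y

lemma g_neg {K : Set Plane} (hK : IsSymmConvexBody K) (x : Plane) :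
    gauge K (-x) = gauge K x := by
  apply gauge_neg
  intro y hy
  have := hK.2.2.2
  rw [this] at hy
  exact hy

lemma g_smul {K : Set Plane} (hK : IsSymmConvexBody K) (c : ℝ) (x : Plane) :
    gauge K (c • x) = |c| * gauge K x := by
  rcases le_total 0 c with h | h
  · rw [gauge_smul_of_nonneg h, abs_of_nonneg h, smul_eq_mul]
  · rw [← g_neg hK, ← neg_smul, gauge_smul_of_nonneg (by linarith), abs_of_nonpos h, smul_eq_mul]

lemma g_pos {K : Set Plane} (hK : IsSymmConvexBody K) {x : Plane} (hx : x ≠ 0) :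
    0 < gauge K x :=
  (gauge_pos (absorbent_nhds_zero (nhds0 hK))
    (NormedSpace.isVonNBounded_of_isBounded ℝ hK.2.1.isBounded)).2 hx

lemma front {K : Set Plane} (hK : IsSymmConvexBody K) {x : Plane} :
    x ∈ frontier K ↔ gauge K x = 1 :=
  (gauge_eq_one_iff_mem_frontier hK.1 (nhds0 hK)).symm

lemma g_cont {K : Set Plane} (hK : IsSymmConvexBody K) : Continuous (gauge K) :=
  continuous_gauge hK.1 (nhds0 hK)

noncomputable def ee (θ : ℝ) : Plane := (Real.cos θ, Real.sin θ)

noncomputable def pp (K : Set Plane) (θ : ℝ) : Plane := (gauge K (ee θ))⁻¹ • ee θ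

def DD (x y : Plane) : ℝ := x.1 * y.2 - x.2 * y.1

lemma ee_ne (θ : ℝ) : ee θ ≠ 0 := by
  intro h
  have h1 : Real.cos θ = 0 := congrArg Prod.fst h
  have h2 : Real.sin θ = 0 := congrArg Prod.snd h
  have := Real.sin_sq_add_cos_sq θ
  rw [h1, h2] at this; norm_num at this

lemma ee_D (s t : ℝ) : DD (ee s) (ee t) = Real.sin (t - s) := by
  simp only [DD, ee, Real.sin_sub]; ring

lemma DD_smul_left (c : ℝ) (x y : Plane) : DD (c • x) y = c * DD x y := by
  simp [DD]; ring
lemma DD_smul_right (c : ℝ) (x y : Plane) : DD x (c • y) = c * DD x y := by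
  simp [DD]; ring
lemma DD_add_left (x y z : Plane) : DD (x + y) z = DD x z + DD y z := by
  simp [DD]; ring
lemma DD_neg_left (x y : Plane) : DD (-x) y = - DD x y := by
  simp [DD]; ring
lemma DD_neg_right (x y : Plane) : DD x (-y) = - DD x y := by
  simp [DD]; ring
lemma DD_swap (x y : Plane) : DD x y = - DD y x := by
  simp [DD]; ring
lemma DD_self (x : Plane) : DD x x = 0 := by
  simp [DD]; ring

/-- the positive radial factor -/
noncomputable def rho (K : Set Plane) (θ : ℝ) : ℝ := (gauge K (ee θ))⁻¹

lemma rho_pos {K : Set Plane} (hK : IsSymmConvexBody K) (θ : ℝ) : 0 < rho K θ :=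
  inv_pos.2 (g_pos hK (ee_ne θ))

lemma pp_eq (K : Set Plane) (θ : ℝ) : pp K θ = rho K θ • ee θ := rfl

lemma pp_gauge {K : Set Plane} (hK : IsSymmConvexBody K) (θ : ℝ) : gauge K (pp K θ) = 1 := by
  rw [pp_eq, g_smul hK, abs_of_pos (rho_pos hK θ), rho, inv_mul_cancel₀ (g_pos hK (ee_ne θ)).ne']

lemma pp_front {K : Set Plane} (hK : IsSymmConvexBody K) (θ : ℝ) : pp K θ ∈ frontier K :=
  (front hK).2 (pp_gauge hK θ)

lemma pp_cont {K : Set Plane} (hK : IsSymmConvexBody K) : Continuous (pp K) := by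
  have he : Continuous ee := by unfold ee; fun_prop
  exact (((g_cont hK).comp he).inv₀ (fun θ => (g_pos hK (ee_ne θ)).ne')).smul he

lemma ee_pi (θ : ℝ) : ee (θ + Real.pi) = - ee θ := by
  simp [ee]

lemma pp_pi {K : Set Plane} (hK : IsSymmConvexBody K) (θ : ℝ) :
    pp K (θ + Real.pi) = - pp K θ := by
  simp only [pp, ee_pi, g_neg hK, smul_neg]

lemma pp_pi' {K : Set Plane} (hK : IsSymmConvexBody K) (θ : ℝ) :
    pp K (θ - Real.pi) = - pp K θ := by
  have := pp_pi hK (θ - Real.pi)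
  rw [sub_add_cancel] at this; rw [this, neg_neg]

lemma pp_int {K : Set Plane} (θ : ℝ) (n : ℤ) :
    pp K (θ + n * (2 * Real.pi)) = pp K θ := by
  simp [pp, ee]

lemma pp_D (K : Set Plane) (s t : ℝ) :
    DD (pp K s) (pp K t) = rho K s * rho K t * Real.sin (t - s) := by
  rw [pp_eq, pp_eq, DD_smul_left, DD_smul_right, ee_D]; ring

lemma pp_D_pos {K : Set Plane} (hK : IsSymmConvexBody K) {s t : ℝ} (h1 : s < t)
    (h2 : t < s + Real.pi) : 0 < DD (pp K s) (pp K t) := by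
  rw [pp_D]
  have := rho_pos hK s
  have := rho_pos hK t
  have := Real.sin_pos_of_pos_of_lt_pi (x := t - s) (by linarith) (by linarith)
  positivity

lemma lt_of_D_pos {K : Set Plane} (hK : IsSymmConvexBody K) {s t : ℝ}
    (h1 : s - Real.pi ≤ t) (h : 0 < DD (pp K s) (pp K t)) : s < t := by
  rcases lt_trichotomy s t with h' | h' | h'
  · exact h'
  · rw [h', DD_self] at h; exact absurd h (lt_irrefl _)
  · rcases h1.lt_or_eq with h1 | h1
    · rw [DD_swap] at h
      have := pp_D_pos hK h' (by linarith)
      linarith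
    · rw [← h1, pp_pi' hK, DD_neg_right, DD_self] at h; simp at h

/-- polar coordinates in any window -/
lemma polar (y : Plane) (hy : y ≠ 0) (a : ℝ) :
    ∃ t c : ℝ, a < t ∧ t ≤ a + 2 * Real.pi ∧ 0 < c ∧ y = c • ee t := by
  set z : ℂ := ⟨y.1, y.2⟩ with hz
  have hz0 : z ≠ 0 := by
    intro h
    apply hy
    have h1 := congrArg Complex.re h
    have h2 := congrArg Complex.im h
    exact Prod.ext h1 h2
  have hn : 0 < ‖z‖ := norm_pos_iff.2 hz0
  have hT : (0:ℝ) < 2 * Real.pi := by positivity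
  have hm := toIocMod_mem_Ioc hT a z.arg
  refine ⟨toIocMod hT a z.arg, ‖z‖, hm.1, hm.2, hn, ?_⟩
  have e1 : ee (toIocMod hT a z.arg) = ee z.arg := by
    have : toIocMod hT a z.arg = z.arg - (toIocDiv hT a z.arg : ℤ) * (2 * Real.pi) := by
      rw [toIocMod, zsmul_eq_mul]
    rw [this]
    simp only [ee, Real.cos_sub_int_mul_two_pi, Real.sin_sub_int_mul_two_pi]
  rw [e1]
  ext
  · simp only [ee, Prod.smul_mk, smul_eq_mul]
    rw [Complex.norm_mul_cos_arg]
  · simp only [ee, Prod.smul_mk, smul_eq_mul]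
    rw [Complex.norm_mul_sin_arg]

lemma polar_front {K : Set Plane} (hK : IsSymmConvexBody K) {y : Plane} (hy : y ∈ frontier K)
    (a : ℝ) : ∃ t, a < t ∧ t ≤ a + 2 * Real.pi ∧ y = pp K t := by
  rw [front hK] at hy
  obtain ⟨t, c, h1, h2, hc, rfl⟩ := polar y (by rintro rfl; simp at hy) a
  refine ⟨t, h1, h2, ?_⟩
  rw [g_smul hK, abs_of_pos hc] at hy
  rw [pp_eq, rho, eq_inv_of_mul_eq_one_left hy]

lemma pp_inj {K : Set Plane} (hK : IsSymmConvexBody K) {a b : ℝ} (h : pp K a = pp K b) :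
    ∃ n : ℤ, n * (2 * Real.pi) = a - b := by
  rw [← Real.cos_eq_one_iff]
  rw [pp_eq, pp_eq] at h
  have ha := rho_pos hK a
  have hb := rho_pos hK b
  have h1 : rho K a * Real.cos a = rho K b * Real.cos b := congrArg Prod.fst h
  have h2 : rho K a * Real.sin a = rho K b * Real.sin b := congrArg Prod.snd h
  have s1 := Real.sin_sq_add_cos_sq a
  have s2 := Real.sin_sq_add_cos_sq b
  have h3 : rho K a ^ 2 = rho K b ^ 2 := by
    calc rho K a ^ 2 = (rho K a * Real.cos a)^2 + (rho K a * Real.sin a)^2 := by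
          linear_combination (-rho K a ^ 2) * s1
      _ = rho K b ^ 2 := by rw [h1, h2]; linear_combination (rho K b ^ 2) * s2
  have h4 : rho K a = rho K b := by
    exact (pow_left_inj₀ ha.le hb.le two_ne_zero).1 h3
  rw [h4] at h1 h2
  have c1 := mul_left_cancel₀ hb.ne' h1
  have c2 := mul_left_cancel₀ hb.ne' h2
  rw [Real.cos_sub, c1, c2]; linarith

lemma pp_inj' {K : Set Plane} (hK : IsSymmConvexBody K) {a b : ℝ} (h : pp K a = pp K b)
    (h1 : a - b < 2 * Real.pi) (h2 : b - a < 2 * Real.pi) : a = b := by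
  obtain ⟨n, hn⟩ := pp_inj hK h
  have hpi := Real.pi_pos
  have n1 : n < 1 := by
    by_contra hh
    have : (1:ℝ) ≤ n := by exact_mod_cast not_lt.1 hh
    nlinarith
  have n2 : -1 < n := by
    by_contra hh
    have : (n:ℝ) ≤ -1 := by exact_mod_cast not_lt.1 hh
    nlinarith
  have : n = 0 := by omega
  rw [this] at hn
  simp at hn; linarith

lemma BOrth_iff {K : Set Plane} (hK : IsSymmConvexBody K) {x y : Plane} (hx : x ∈ frontier K)
    (hD : 0 < DD x y) : BOrth K x y ↔ ∀ z, |DD z y| ≤ gauge K z * DD x y := by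
  rw [front hK] at hx
  constructor
  · intro h z
    have hz : z = (DD z y / DD x y) • x + (DD x z / DD x y) • y := by
      ext
      · simp only [Prod.fst_add, Prod.smul_fst, smul_eq_mul]
        field_simp
        simp only [DD]; ring
      · simp only [Prod.snd_add, Prod.smul_snd, smul_eq_mul]
        field_simp
        simp only [DD]; ring
    by_cases h0 : DD z y = 0
    · rw [h0, abs_zero]
      exact mul_nonneg (gauge_nonneg _) hD.le
    have hz' : z = (DD z y / DD x y) • (x + (DD x z / DD z y) • y) := by
      rw [smul_add, smul_smul]
      convert hz using 3
      field_simp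
    have := h (DD x z / DD z y)
    rw [hx] at this
    have e := congrArg (gauge K) hz'
    rw [g_smul hK, abs_div, abs_of_pos hD] at e
    rw [e, mul_right_comm, div_mul_cancel₀ _ hD.ne']
    nlinarith [abs_nonneg (DD z y)]
  · intro h t
    have := h (x + t • y)
    rw [DD_add_left, DD_smul_left, DD_self, mul_zero, add_zero, abs_of_pos hD] at this
    rw [hx]
    by_contra hh
    nlinarith [not_le.1 hh]

lemma BOrth_neg_right {K : Set Plane} {x y : Plane} (h : BOrth K x y) : BOrth K x (-y) := by
  intro t
  have := h (-t)
  rwa [neg_smul, ← smul_neg] at this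

lemma BOrth_neg_left {K : Set Plane} (hK : IsSymmConvexBody K) {x y : Plane} (h : BOrth K x y) :
    BOrth K (-x) y := by
  intro t
  have := h (-t)
  rw [← g_neg hK (x + _)] at this
  rw [g_neg hK]
  convert this using 2
  rw [neg_add, neg_smul, neg_neg]

lemma BOrth_D_ne {K : Set Plane} (hK : IsSymmConvexBody K) {s t : ℝ}
    (h : BOrth K (pp K s) (pp K t)) : DD (pp K s) (pp K t) ≠ 0 := by
  intro h0
  rw [pp_D] at h0
  have hs := rho_pos hK s
  have ht := rho_pos hK t
  have h1 : Real.sin (t - s) = 0 := by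
    rcases mul_eq_zero.1 h0 with h | h
    · exact absurd h (by positivity)
    · exact h
  obtain ⟨n, hn⟩ := Real.sin_eq_zero_iff.1 h1
  have hc : ee t = Real.cos (t - s) • ee s := by
    have : t = s + (t - s) := by ring
    ext
    · simp only [ee, Prod.smul_mk, smul_eq_mul]
      conv_lhs => rw [this]
      rw [Real.cos_add, h1]; ring
    · simp only [ee, Prod.smul_mk, smul_eq_mul]
      conv_lhs => rw [this]
      rw [Real.sin_add, h1]; ring
  have hc2 : Real.cos (t - s) ≠ 0 := by
    intro h2
    have := Real.sin_sq_add_cos_sq (t - s)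
    rw [h1, h2] at this; norm_num at this
  have := h (- (rho K s / (rho K t * Real.cos (t - s))))
  have e : pp K s + (-(rho K s / (rho K t * Real.cos (t - s)))) • pp K t = 0 := by
    rw [pp_eq, pp_eq, hc, smul_smul, smul_smul, ← add_smul]
    have : rho K s + -(rho K s / (rho K t * Real.cos (t - s))) * (rho K t * Real.cos (t - s)) = 0 := by
      field_simp; ring
    rw [mul_assoc] at *
    rw [this, zero_smul]
  rw [e, gauge_zero, pp_gauge hK] at this
  norm_num at this
/-- Birkhoff orthogonality in the angular parameters -/
def RR (K : Set Plane) (s t : ℝ) : Prop :=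
  s < t ∧ t < s + Real.pi ∧ ∀ z, |DD z (pp K t)| ≤ gauge K z * DD (pp K s) (pp K t)

lemma RR_iff {K : Set Plane} (hK : IsSymmConvexBody K) {s t : ℝ} (h1 : s < t)
    (h2 : t < s + Real.pi) : RR K s t ↔ BOrth K (pp K s) (pp K t) := by
  rw [BOrth_iff hK (pp_front hK s) (pp_D_pos hK h1 h2)]
  exact ⟨fun h => h.2.2, fun h => ⟨h1, h2, h⟩⟩

lemma RR_mono {K : Set Plane} (hK : IsSymmConvexBody K) (s t s' t' : ℝ) (hs : s < s')
    (h : RR K s t) (h' : RR K s' t') : t ≤ t' := by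
  by_contra hh
  push Not at hh
  obtain ⟨a1, a2, a3⟩ := h
  obtain ⟨b1, b2, b3⟩ := h'
  have c1 := a3 (pp K s')
  have c2 := b3 (pp K s)
  rw [pp_gauge hK, one_mul, pp_D, pp_D] at c1 c2
  have r1 := rho_pos hK s
  have r2 := rho_pos hK s'
  have r3 := rho_pos hK t
  have r4 := rho_pos hK t'
  have d1 := (le_abs_self _).trans c1
  have d2 := (le_abs_self _).trans c2
  have p1 : 0 < Real.sin (t - s') := Real.sin_pos_of_pos_of_lt_pi (by linarith) (by linarith)
  have p2 : 0 < Real.sin (t' - s) := Real.sin_pos_of_pos_of_lt_pi (by linarith) (by linarith)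
  have p3 : 0 < Real.sin (s' - s) := Real.sin_pos_of_pos_of_lt_pi (by linarith) (by linarith)
  have p4 : 0 < Real.sin (t - t') := Real.sin_pos_of_pos_of_lt_pi (by linarith) (by linarith)
  have q := mul_le_mul d1 d2 (by positivity) ((by positivity : (0:ℝ) ≤ _).trans d1)
  have q' : (rho K s * rho K s' * rho K t * rho K t') * (Real.sin (t - s') * Real.sin (t' - s)) ≤
      (rho K s * rho K s' * rho K t * rho K t') * (Real.sin (t - s) * Real.sin (t' - s')) := by
    linarith
  have q2 := le_of_mul_le_mul_left q' (by positivity)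
  have id : Real.sin (t - s') * Real.sin (t' - s) - Real.sin (t - s) * Real.sin (t' - s')
      = Real.sin (s' - s) * Real.sin (t - t') := by
    simp only [Real.sin_sub]
    ring
  nlinarith [mul_pos p3 p4]

lemma RR_shift {K : Set Plane} (hK : IsSymmConvexBody K) (s t : ℝ) :
    RR K s t ↔ RR K (s + Real.pi) (t + Real.pi) := by
  simp only [RR, pp_pi hK, DD_neg_right, DD_neg_left, abs_neg, neg_neg, add_lt_add_iff_right]

lemma RR_tot {K : Set Plane} (hK : IsSymmConvexBody K) (s : ℝ) : ∃ t, RR K s t := by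
  have hx : pp K s ∉ interior K := (pp_front hK s).2
  obtain ⟨f, hf⟩ := geometric_hahn_banach_open_point hK.1.interior isOpen_interior hx
  have h0 : 0 < f (pp K s) := by
    have := hf 0 (mem_interior_iff_mem_nhds.2 (nhds0 hK))
    simpa using this
  have hlt : ∀ z, gauge K z < 1 → f z < f (pp K s) := by
    intro z hz
    exact hf z ((gauge_lt_one_iff_mem_interior hK.1 (nhds0 hK)).1 hz)
  have hle1 : ∀ z, f z ≤ gauge K z * f (pp K s) := by
    intro z
    refine le_of_forall_pos_lt_add fun ε hε => ?_
    have hg : 0 ≤ gauge K z := gauge_nonneg _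
    set c := gauge K z + ε / f (pp K s) with hcdef
    have hc : 0 < c := by positivity
    have := hlt (c⁻¹ • z) (by
      rw [g_smul hK, abs_of_pos (inv_pos.2 hc), inv_mul_lt_iff₀ hc, mul_one, hcdef]
      have : 0 < ε / f (pp K s) := by positivity
      linarith)
    rw [map_smul, smul_eq_mul, inv_mul_lt_iff₀ hc, hcdef, add_mul, div_mul_cancel₀ _ h0.ne'] at this
    exact this
  have hle : ∀ z, |f z| ≤ gauge K z * f (pp K s) := by
    intro z
    rw [abs_le]
    refine ⟨?_, hle1 z⟩
    have := hle1 (-z)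
    rw [g_neg hK, map_neg] at this
    linarith
  set y : Plane := (- f (0, 1), f (1, 0)) with hy
  have hD : ∀ z, DD z y = f z := by
    intro z
    have : z = z.1 • ((1, 0) : Plane) + z.2 • ((0, 1) : Plane) := by
      ext <;> simp
    conv_rhs => rw [this]
    rw [map_add, map_smul, map_smul]
    simp only [DD, hy, smul_eq_mul]; ring
  have hy0 : y ≠ 0 := by
    intro h
    have := hD (pp K s)
    rw [h] at this
    simp [DD] at this
    linarith
  obtain ⟨t, c, t1, t2, hc, hyt⟩ := polar y hy0 (s - Real.pi)
  have hr := rho_pos hK t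
  have hpt : pp K t = (rho K t / c) • y := by
    rw [hyt, smul_smul, div_mul_cancel₀ _ hc.ne', pp_eq]
  have hDp : 0 < DD (pp K s) (pp K t) := by
    rw [hpt, DD_smul_right, hD]; positivity
  have hst := lt_of_D_pos hK t1.le hDp
  refine ⟨t, hst, ?_, ?_⟩
  · rcases (show t ≤ s + Real.pi by linarith).lt_or_eq with h | h
    · exact h
    · rw [h, pp_pi hK, DD_neg_right, DD_self] at hDp
      simp at hDp
  · intro z
    rw [hpt, DD_smul_right, DD_smul_right, hD, hD, abs_mul, abs_of_pos (by positivity : 0 < rho K t / c)]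
    have := mul_le_mul_of_nonneg_left (hle z) (by positivity : 0 ≤ rho K t / c)
    linarith

lemma RR_of_D {K : Set Plane} (hK : IsSymmConvexBody K) {x : Plane} {t : ℝ}
    (hx : x ∈ frontier K) (hD : 0 < DD x (pp K t))
    (h : ∀ z, |DD z (pp K t)| ≤ gauge K z * DD x (pp K t)) :
    ∃ s, RR K s t ∧ x = pp K s := by
  obtain ⟨s, s1, s2, rfl⟩ := polar_front hK hx (t - Real.pi)
  have h1 : s < t := by
    by_contra hh
    push Not at hh
    rcases (show s ≤ t + Real.pi by linarith).lt_or_eq with h' | h'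
    · rcases hh.lt_or_eq with hh | hh
      · have := pp_D_pos hK hh h'
        rw [DD_swap] at this; linarith
      · rw [hh, DD_self] at hD; exact lt_irrefl _ hD
    · rw [h', pp_pi hK, DD_neg_left, DD_self] at hD
      simp at hD
  exact ⟨s, ⟨h1, by linarith, h⟩, rfl⟩

lemma RR_tot' {K : Set Plane} (hK : IsSymmConvexBody K) (t : ℝ) : ∃ s, RR K s t := by
  have hpi := Real.pi_pos
  have hcont : Continuous (fun s => DD (pp K s) (pp K t)) := by
    have := pp_cont hK
    exact (this.fst.mul continuous_const).sub (this.snd.mul continuous_const)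
  obtain ⟨s, -, hs⟩ := isCompact_Icc.exists_isMaxOn (s := Icc (t - Real.pi) (t + Real.pi))
    ⟨t, by constructor <;> linarith⟩ hcont.continuousOn
  have hmax : ∀ u, DD (pp K u) (pp K t) ≤ DD (pp K s) (pp K t) := by
    intro u
    obtain ⟨v, v1, v2, hv⟩ := polar_front hK (pp_front hK u) (t - Real.pi)
    rw [hv]
    exact hs ⟨v1.le, by linarith⟩
  have hpos : 0 < DD (pp K s) (pp K t) :=
    (pp_D_pos hK (s := t - Real.pi / 2) (t := t) (by linarith) (by linarith)).trans_le (hmax _)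
  have habs : ∀ u, |DD (pp K u) (pp K t)| ≤ DD (pp K s) (pp K t) := by
    intro u
    rw [abs_le]
    refine ⟨?_, hmax u⟩
    have := hmax (u + Real.pi)
    rw [pp_pi hK, DD_neg_left] at this; linarith
  obtain ⟨s', h, -⟩ := RR_of_D hK (pp_front hK s) hpos (by
    intro z
    by_cases hz : z = 0
    · rw [hz]; simp [DD]
    have hg := g_pos hK hz
    obtain ⟨u, -, -, hu⟩ := polar_front hK (y := (gauge K z)⁻¹ • z) (by
      rw [front hK, g_smul hK, abs_of_pos (inv_pos.2 hg), inv_mul_cancel₀ hg.ne']) 0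
    have := habs u
    rw [← hu, DD_smul_left, abs_mul, abs_of_pos (inv_pos.2 hg), inv_mul_le_iff₀ hg] at this
    exact this)
  exact ⟨s', h⟩

lemma auer_iff {K : Set Plane} (hK : IsSymmConvexBody K) (s : ℝ) :
    pp K s ∈ Auerbach K ↔ ∃ t, RR K s t ∧ RR K t (s + Real.pi) := by
  constructor
  · rintro ⟨-, y, hy, h1, h2⟩
    obtain ⟨t, t1, t2, rfl⟩ := polar_front hK hy (s - Real.pi)
    have hne := BOrth_D_ne hK h1
    have key : ∀ t, s < t → t < s + Real.pi → BOrth K (pp K s) (pp K t) →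
        BOrth K (pp K t) (pp K s) → ∃ t, RR K s t ∧ RR K t (s + Real.pi) := by
      intro t l1 l2 b1 b2
      refine ⟨t, (RR_iff hK l1 l2).2 b1, (RR_iff hK l2 (by linarith)).2 ?_⟩
      rw [pp_pi hK]; exact BOrth_neg_right b2
    rcases lt_trichotomy s t with h | h | h
    · rcases (show t ≤ s + Real.pi by linarith).lt_or_eq with h' | h'
      · exact key t h h' h1 h2
      · rw [h', pp_pi hK, DD_neg_right, DD_self] at hne
        simp at hne
    · rw [h, DD_self] at hne; exact absurd rfl hne
    · refine key (t + Real.pi) (by linarith) (by linarith) ?_ ?_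
      · rw [pp_pi hK]; exact BOrth_neg_right h1
      · rw [pp_pi hK]; exact BOrth_neg_left hK h2
  · rintro ⟨t, h1, h2⟩
    refine ⟨pp_front hK s, pp K t, pp_front hK t, (RR_iff hK h1.1 h1.2.1).1 h1, ?_⟩
    have := (RR_iff hK h2.1 h2.2.1).1 h2
    rw [pp_pi hK] at this
    simpa using BOrth_neg_right this

lemma seg_iff {K : Set Plane} (hK : IsSymmConvexBody K) (s : ℝ) :
    pp K s ∈ SegUnion K ↔ ∃ s₁ s₂ t, s₁ < s ∧ s < s₂ ∧ RR K s₁ t ∧ RR K s₂ t := by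
  constructor
  · rintro ⟨a, b, hab, hsub, al, be, ha, hb, hsum, hx⟩
    obtain ⟨t, ht⟩ := RR_tot hK s
    have hx0 := pp_D_pos hK ht.1 ht.2.1
    have af := hsub (left_mem_segment ℝ a b)
    have bf := hsub (right_mem_segment ℝ a b)
    have a1 := (le_abs_self _).trans (ht.2.2 a)
    have b1 := (le_abs_self _).trans (ht.2.2 b)
    rw [(front hK).1 af, one_mul] at a1
    rw [(front hK).1 bf, one_mul] at b1
    have hxx : al * DD a (pp K t) + be * DD b (pp K t) = DD (pp K s) (pp K t) := by
      rw [← hx, DD_add_left, DD_smul_left, DD_smul_left]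
    have a2 : DD a (pp K t) = DD (pp K s) (pp K t) := by
      apply le_antisymm a1
      by_contra hh
      push Not at hh
      nlinarith
    have b2 : DD b (pp K t) = DD (pp K s) (pp K t) := by
      apply le_antisymm b1
      by_contra hh
      push Not at hh
      nlinarith
    have h2 := ht.2.2
    obtain ⟨s₁, r1, rfl⟩ := RR_of_D hK af (by rw [a2]; exact hx0) (by rw [a2]; exact h2)
    obtain ⟨s₂, r2, rfl⟩ := RR_of_D hK bf (by rw [b2]; exact hx0) (by rw [b2]; exact h2)
    have key : ∀ s₁ s₂ al be : ℝ, RR K s₁ t → RR K s₂ t → s₁ < s₂ → 0 < al → 0 < be →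
        al • pp K s₁ + be • pp K s₂ = pp K s → s₁ < s ∧ s < s₂ := by
      intro s₁ s₂ al be r1 r2 hlt ha hb hx
      have hd := pp_D_pos hK hlt (by linarith [r1.2.1, r2.1])
      constructor
      · apply lt_of_D_pos hK (by linarith [r1.1, ht.2.1])
        rw [DD_swap, ← hx, DD_add_left, DD_smul_left, DD_smul_left, DD_self, DD_swap (pp K s₂)]
        have := mul_pos hb hd
        linarith
      · apply lt_of_D_pos hK (by linarith [r2.2.1, ht.1])
        rw [← hx, DD_add_left, DD_smul_left, DD_smul_left, DD_self]
        have := mul_pos ha hd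
        linarith
    rcases lt_trichotomy s₁ s₂ with h | h | h
    · obtain ⟨k1, k2⟩ := key s₁ s₂ al be r1 r2 h ha hb hx
      exact ⟨s₁, s₂, t, k1, k2, r1, r2⟩
    · exact absurd (by rw [h]) hab
    · obtain ⟨k1, k2⟩ := key s₂ s₁ be al r2 r1 h hb ha (by rw [add_comm]; exact hx)
      exact ⟨s₂, s₁, t, k1, k2, r2, r1⟩
  · rintro ⟨s₁, s₂, t, h1, h2, r1, r2⟩
    have hpos := pp_D_pos hK r1.1 r1.2.1
    have heq : DD (pp K s₂) (pp K t) = DD (pp K s₁) (pp K t) := by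
      have c1 := (le_abs_self _).trans (r1.2.2 (pp K s₂))
      have c2 := (le_abs_self _).trans (r2.2.2 (pp K s₁))
      rw [pp_gauge hK, one_mul] at c1 c2
      exact le_antisymm c1 c2
    have hd := pp_D_pos hK (h1.trans h2) (by linarith [r1.2.1, r2.1])
    have hge : ∀ z, DD z (pp K t) ≤ gauge K z * DD (pp K s₁) (pp K t) :=
      fun z => (le_abs_self _).trans (r1.2.2 z)
    refine ⟨pp K s₁, pp K s₂, ?_, ?_, ?_⟩
    · intro h
      rw [h, DD_self] at hd; exact lt_irrefl _ hd
    · rintro z ⟨al, be, ha, hb, hsum, rfl⟩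
      rw [front hK]
      apply le_antisymm
      · refine (g_add hK _ _).trans ?_
        rw [g_smul hK, g_smul hK, pp_gauge hK, pp_gauge hK, abs_of_nonneg ha, abs_of_nonneg hb]
        linarith
      · have := hge (al • pp K s₁ + be • pp K s₂)
        rw [DD_add_left, DD_smul_left, DD_smul_left, heq, ← add_mul, hsum] at this
        exact le_of_mul_le_mul_right this hpos
    · have d1 := pp_D_pos hK h1 (by linarith [r1.2.1, r2.1])
      have d2 := pp_D_pos hK h2 (by linarith [r1.2.1, r2.1])
      set x := pp K s with hx
      set a := pp K s₁ with ha
      set b := pp K s₂ with hb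
      have hab : (DD x b / DD a b) • a + (DD a x / DD a b) • b = x := by
        ext
        · simp only [Prod.fst_add, Prod.smul_fst, smul_eq_mul]
          field_simp
          simp only [DD]; ring
        · simp only [Prod.snd_add, Prod.smul_snd, smul_eq_mul]
          field_simp
          simp only [DD]; ring
      have p1 : 0 < DD x b / DD a b := by positivity
      have p2 : 0 < DD a x / DD a b := by positivity
      refine ⟨_, _, p1, p2, ?_, hab⟩
      have gx : gauge K x = 1 := pp_gauge hK s
      apply le_antisymm
      · have := hge x
        rw [gx] at this
        nth_rewrite 1 [← hab] at this
        rw [DD_add_left, DD_smul_left, DD_smul_left, heq, ← add_mul] at this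
        exact le_of_mul_le_mul_right this hpos
      · have := g_add hK ((DD x b / DD a b) • a) ((DD a x / DD a b) • b)
        rw [hab, gx, g_smul hK, g_smul hK, pp_gauge hK, pp_gauge hK, abs_of_pos p1, abs_of_pos p2] at this
        linarith

/-- arcs -/
lemma arc_sub {K : Set Plane} (hK : IsSymmConvexBody K) {s t : ℝ} (h1 : s < t)
    (h2 : t < s + Real.pi) {C : Set Plane} (hC : C ⊆ frontier K) (hconn : IsPreconnected C)
    (hs : pp K s ∈ C) (ht : pp K t ∈ C) (hanti : ∀ z ∈ C, -z ∉ C) : pp K '' Icc s t ⊆ C := by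
  rintro _ ⟨u, hu, rfl⟩
  by_contra hcon
  have hsu : s < u := lt_of_le_of_ne hu.1 (by rintro rfl; exact hcon hs)
  have hut : u < t := lt_of_le_of_ne hu.2 (by rintro rfl; exact hcon ht)
  have cD1 : Continuous (fun z => DD (pp K u) z) := by unfold DD; fun_prop
  have cD2 : Continuous (fun z => DD (pp K s) z) := by unfold DD; fun_prop
  let U : Set Plane := {z | 0 < DD (pp K u) z ∧ 0 < DD (pp K s) z}
  let V : Set Plane := {z | DD (pp K u) z < 0} ∪ {z | DD (pp K s) z < 0}
  have hU : IsOpen U := (isOpen_lt continuous_const cD1).inter (isOpen_lt continuous_const cD2)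
  have hV : IsOpen V := (isOpen_lt cD1 continuous_const).union (isOpen_lt cD2 continuous_const)
  have hsuD := pp_D_pos hK hsu (by linarith)
  have cover : C ⊆ U ∪ V := by
    intro z hz
    obtain ⟨v, v1, v2, rfl⟩ := polar_front hK (hC hz) (s - Real.pi)
    by_contra hh
    simp only [U, V, mem_union, mem_ofPred_eq, not_or, not_and, not_lt] at hh
    obtain ⟨k1, k2, k3⟩ := hh
    have hsv : s ≤ v := by
      by_contra hlt
      push Not at hlt
      have := pp_D_pos hK hlt (by linarith)
      rw [DD_swap] at this; linarith
    have hvlt : v < s + Real.pi := by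
      apply lt_of_le_of_ne (by linarith)
      rintro rfl
      rw [pp_pi hK] at hz
      exact hanti _ hs hz
    rcases lt_trichotomy v u with h | h | h
    · have := pp_D_pos hK h (by linarith)
      rw [DD_swap] at this; linarith
    · rw [h] at hz; exact hcon hz
    · have e1 := pp_D_pos hK h (by linarith)
      have e2 := pp_D_pos hK (hsu.trans h) hvlt
      linarith [k1 e1]
  obtain ⟨z, hz, hzU, hzV⟩ := hconn U V hU hV cover
    ⟨_, ht, pp_D_pos hK hut (by linarith), pp_D_pos hK h1 h2⟩
    ⟨_, hs, Or.inl (by show DD (pp K u) (pp K s) < 0; rw [DD_swap]; linarith)⟩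
  rcases hzV with h | h
  · exact lt_asymm h hzU.1
  · exact lt_asymm h hzU.2

lemma arc_anti {K : Set Plane} (hK : IsSymmConvexBody K) {s t : ℝ}
    (h2 : t < s + Real.pi) : ∀ z ∈ pp K '' Icc s t, -z ∉ pp K '' Icc s t := by
  rintro _ ⟨u, hu, rfl⟩ ⟨v, hv, h⟩
  have hpi := Real.pi_pos
  rw [← pp_pi hK] at h
  have := pp_inj' hK h (by linarith [hu.1, hu.2, hv.1, hv.2]) (by linarith [hu.1, hu.2, hv.1, hv.2])
  linarith [hu.1, hu.2, hv.1, hv.2]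

lemma arc_compact {K : Set Plane} (hK : IsSymmConvexBody K) (s t : ℝ) :
    IsCompact (pp K '' Icc s t) := isCompact_Icc.image (pp_cont hK)

lemma arc_isBArc {K : Set Plane} (hK : IsSymmConvexBody K) {s t : ℝ} (h1 : s < t)
    (h2 : t < s + Real.pi) : IsBArc K (pp K '' Icc s t) (pp K s) (pp K t) := by
  refine ⟨?_, (arc_compact hK s t).isClosed, isPreconnected_Icc.image _ (pp_cont hK).continuousOn,
    ⟨s, ⟨le_rfl, h1.le⟩, rfl⟩, ⟨t, ⟨h1.le, le_rfl⟩, rfl⟩, arc_anti hK h2, ?_⟩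
  · rintro _ ⟨u, -, rfl⟩; exact pp_front hK u
  · intro C' hsub hcl hconn hs ht
    refine subset_antisymm hsub (arc_sub hK h1 h2 ?_ hconn hs ht ?_)
    · rintro _ hz
      obtain ⟨u, -, rfl⟩ := hsub hz
      exact pp_front hK u
    · intro z hz hz'
      exact arc_anti hK h2 z (hsub hz) (hsub hz')

lemma arc_eq {K : Set Plane} (hK : IsSymmConvexBody K) {s t : ℝ} (h1 : s < t)
    (h2 : t < s + Real.pi) {C : Set Plane} (hC : IsBArc K C (pp K s) (pp K t)) :
    C = pp K '' Icc s t := by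
  obtain ⟨c1, c2, c3, c4, c5, c6, c7⟩ := hC
  symm
  obtain ⟨-, d2, d3, d4, d5, -⟩ := arc_isBArc hK h1 h2
  exact c7 _ (arc_sub hK h1 h2 c1 c3 c4 c5 c6) d2 d3 d4 d5

lemma IsBArc.swap {K C : Set Plane} {x y : Plane} (h : IsBArc K C x y) : IsBArc K C y x := by
  obtain ⟨c1, c2, c3, c4, c5, c6, c7⟩ := h
  exact ⟨c1, c2, c3, c5, c4, c6, fun C' a b c d e => c7 C' a b c e d⟩
lemma absB_eq {K : Set Plane} (hK : IsSymmConvexBody K) :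
    absB (RR K) = pp K ⁻¹' (Auerbach K \ SegUnion K) := by
  ext s
  simp only [absB, mem_ofPred_eq, mem_preimage, mem_sdiff, auer_iff hK, seg_iff hK]

lemma absB_countable {K : Set Plane} (hK : IsSymmConvexBody K) :
    (absB (RR K)).Countable ↔ (Auerbach K \ SegUnion K).Countable := by
  rw [absB_eq hK]
  constructor
  · intro h
    refine (h.image (pp K)).mono ?_
    intro x hx
    obtain ⟨t, -, -, rfl⟩ := polar_front hK hx.1.1 0
    exact ⟨t, hx, rfl⟩
  · intro h
    have : pp K ⁻¹' (Auerbach K \ SegUnion K) ⊆ ⋃ n : ℤ,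
        (Ico (n * Real.pi) ((n + 1) * Real.pi) ∩ pp K ⁻¹' (Auerbach K \ SegUnion K)) := by
      intro x hx
      obtain ⟨n, h1, h2⟩ := exists_cell x
      exact mem_iUnion.2 ⟨n, ⟨h1, h2⟩, hx⟩
    refine (countable_iUnion fun n : ℤ => ?_).mono this
    refine MapsTo.countable_of_injOn (f := pp K) (t := Auerbach K \ SegUnion K)
      (fun x hx => hx.2) ?_ h
    intro a ha b hb hab
    have hpi := Real.pi_pos
    exact pp_inj' hK hab (by linarith [ha.1.1, ha.1.2, hb.1.1, hb.1.2])
      (by linarith [ha.1.1, ha.1.2, hb.1.1, hb.1.2])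

lemma dir_fwd {K : Set Plane} (hK : IsSymmConvexBody K) (μ : Measure Plane)
    (hμ : IsBMeasure K μ) : ¬ (absB (RR K)).Countable := by
  have hpi := Real.pi_pos
  obtain ⟨⟨hf, hf', hsym, h0⟩, hB⟩ := hμ
  have : IsFiniteMeasure μ := by
    constructor
    rw [← union_compl_self (frontier K)]
    refine (measure_union_le _ _).trans_lt ?_
    rw [hf, hf', add_zero]; exact ENNReal.ofReal_lt_top
  let I : ℝ → ℝ → ℝ := fun s t => μ.real (pp K '' Icc s t)
  have Iadd : ∀ s u t, s ≤ u → u ≤ t → t ≤ s + 2 * Real.pi → I s t = I s u + I u t := by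
    intro s u t h1 h2 h3
    simp only [I]
    rw [← measureReal_union_add_inter (arc_compact hK u t).isClosed.measurableSet, ← image_union,
      Icc_union_Icc_eq_Icc h1 h2]
    have : μ (pp K '' Icc s u ∩ pp K '' Icc u t) = 0 := by
      refine measure_mono_null (t := {pp K s} ∪ {pp K u}) ?_ ?_
      · rintro _ ⟨⟨a, ha, rfl⟩, ⟨b, hb, hab⟩⟩
        by_cases h : b - a < 2 * Real.pi
        · have := pp_inj' hK hab h (by linarith [ha.1, ha.2, hb.1, hb.2])
          right
          have e : a = u := by linarith [ha.1, ha.2, hb.1, hb.2]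
          rw [e]; rfl
        · left
          have e : a = s := by linarith [ha.1, ha.2, hb.1, hb.2]
          rw [e]; rfl
      · rw [measure_union_null_iff]; exact ⟨h0 _, h0 _⟩
    simp [Measure.real, this]
  have Ish : ∀ s t, I (s + Real.pi) (t + Real.pi) = I s t := by
    intro s t
    simp only [I, Measure.real]
    rw [← hsym (pp K '' Icc s t)]
    congr 2
    ext x
    simp only [mem_image, mem_neg]
    constructor
    · rintro ⟨a, ha, rfl⟩
      exact ⟨a - Real.pi, ⟨by linarith [ha.1], by linarith [ha.2]⟩, pp_pi' hK a⟩
    · rintro ⟨a, ha, h⟩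
      refine ⟨a + Real.pi, ⟨by linarith [ha.1], by linarith [ha.2]⟩, ?_⟩
      rw [pp_pi hK, h, neg_neg]
  have Ishn : ∀ (n : ℤ) s t, I (s + n * Real.pi) (t + n * Real.pi) = I s t := by
    intro n
    induction n using Int.induction_on with
    | zero => simp
    | succ k ih =>
      intro s t
      have h := Ish (s + ((k:ℤ):ℝ) * Real.pi) (t + ((k:ℤ):ℝ) * Real.pi)
      rw [← ih s t, ← h]; push_cast; ring_nf
    | pred k ih =>
      intro s t
      rw [← ih s t, ← Ish (s + ((-(k:ℤ) - 1 : ℤ) : ℝ) * Real.pi)]; push_cast; ring_nf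
  let m := arcMass μ (pp K)
  have mI : ∀ u, m u = I 0 u := fun u => rfl
  have mm : Monotone m := arcMass_mono μ _
  have mc : Continuous m := arcMass_cont μ _ (pp_cont hK) h0
  have m0 : m 0 = 0 := by simp [m, arcMass, Measure.real, h0]
  have m1 : m Real.pi = Real.pi := by
    have e1 := Iadd 0 Real.pi (2 * Real.pi) hpi.le (by linarith) (by linarith)
    have e2 := Ish 0 Real.pi
    rw [zero_add, ← two_mul] at e2
    have e3 : I 0 (2 * Real.pi) = 2 * Real.pi := by
      simp only [I, Measure.real]
      have : pp K '' Icc 0 (2 * Real.pi) = frontier K := by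
        apply subset_antisymm
        · rintro _ ⟨u, -, rfl⟩; exact pp_front hK u
        · intro x hx
          obtain ⟨t, h1, h2, rfl⟩ := polar_front hK hx 0
          exact ⟨t, ⟨h1.le, by linarith⟩, rfl⟩
      rw [this, hf, ENNReal.toReal_ofReal (by positivity)]
    rw [mI]; linarith
  refine abs_fwd (RR K) (RR_tot hK) (periodize m) (periodize_mono m m0 m1 (mm.monotoneOn _))
    (periodize_cont m m0 m1 mc.continuousOn) (periodize_shift m) ?_
  intro s t hst
  have hI : I s t = Real.pi / 2 := by
    simp only [I, Measure.real]
    rw [hB _ _ _ (arc_isBArc hK hst.1 hst.2.1) ((RR_iff hK hst.1 hst.2.1).1 hst),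
      ENNReal.toReal_ofReal (by positivity)]
  obtain ⟨n, n1, n2⟩ := exists_cell s
  have hst1 := hst.1
  have hst2 := hst.2.1
  have hI0 := Ishn n (s - n * Real.pi) (t - n * Real.pi)
  rw [sub_add_cancel, sub_add_cancel, hI] at hI0
  rw [periodize_eq m m0 m1 n s n1 n2.le]
  rcases le_total t ((n + 1) * Real.pi) with h | h
  · rw [periodize_eq m m0 m1 n t (by linarith) h, mI, mI,
      Iadd 0 (s - n * Real.pi) (t - n * Real.pi) (by linarith) (by linarith) (by linarith)]
    linarith
  · rw [periodize_eq m m0 m1 (n + 1) t (by push_cast; linarith) (by push_cast; linarith), mI, mI]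
    have e1 := Iadd (s - n * Real.pi) Real.pi (t - n * Real.pi) (by linarith) (by linarith)
      (by linarith)
    have e2 := Iadd 0 (s - n * Real.pi) Real.pi (by linarith) (by linarith) (by linarith)
    have e3 := Ish 0 (t - (n + 1 : ℤ) * Real.pi)
    have e4 : t - ((n + 1 : ℤ) : ℝ) * Real.pi + Real.pi = t - n * Real.pi := by push_cast; ring
    rw [e4, zero_add] at e3
    rw [← mI Real.pi, m1] at e2
    push_cast at *
    linarith

lemma dir_bwd {K : Set Plane} (hK : IsSymmConvexBody K) (F : ℝ → ℝ) (hm : Monotone F)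
    (hc : Continuous F) (hp : ∀ x, F (x + Real.pi) = F x + Real.pi)
    (hR : ∀ s t, RR K s t → F t = F s + Real.pi / 2) : ∃ μ, IsBMeasure K μ := by
  have hpi := Real.pi_pos
  let f : StieltjesFunction ℝ := ⟨F, hm, fun x => hc.continuousWithinAt⟩
  have fF : ∀ x, f x = F x := fun _ => rfl
  let σ := f.measure
  have hleft : ∀ x, Function.leftLim f x = F x := by
    intro x
    exact hc.continuousAt.continuousWithinAt.leftLim_eq
  have σIoc : ∀ a b, σ (Ioc a b) = ENNReal.ofReal (F b - F a) := fun a b => f.measure_Ioc a b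
  have σIcc : ∀ a b, σ (Icc a b) = ENNReal.ofReal (F b - F a) := by
    intro a b
    show f.measure _ = _
    rw [f.measure_Icc, hleft, fF]
  have σ0 : ∀ a, σ {a} = 0 := by
    intro a
    show f.measure _ = _
    rw [f.measure_singleton, hleft, fF]; simp
  have σinv : ∀ (n : ℤ) (S : Set ℝ), MeasurableSet S →
      σ ((fun x => x + n * Real.pi) ⁻¹' S) = σ S := by
    intro n S hS
    have hmeas : Measurable (fun x : ℝ => x + n * Real.pi) := by fun_prop
    have : σ = Measure.map (fun x : ℝ => x + n * Real.pi) σ := by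
      apply Measure.ext_of_Ioc
      intro a b _
      rw [Measure.map_apply hmeas measurableSet_Ioc, preimage_add_const_Ioc, σIoc, σIoc]
      have h1 := shift_int F hp (a - n * Real.pi) n
      have h2 := shift_int F hp (b - n * Real.pi) n
      rw [sub_add_cancel] at h1 h2
      rw [h1, h2]; congr 1; ring
    rw [← Measure.map_apply hmeas hS, ← this]
  have hT : (0:ℝ) < 2 * Real.pi := by positivity
  have : VAddInvariantMeasure (AddSubgroup.zmultiples (2 * Real.pi)) ℝ σ := by
    constructor
    rintro ⟨c, hcm⟩ S hS
    obtain ⟨n, rfl⟩ := AddSubgroup.mem_zmultiples_iff.1 hcm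
    rw [← σinv (2 * n) S hS]
    congr 2
    funext x
    rw [AddSubgroup.vadd_def, vadd_eq_add]
    simp; ring
  have window : ∀ (a b : ℝ) (S : Set Plane), MeasurableSet S →
      σ (pp K ⁻¹' S ∩ Ioc a (a + 2 * Real.pi)) = σ (pp K ⁻¹' S ∩ Ioc b (b + 2 * Real.pi)) := by
    intro a b S hS
    apply IsAddFundamentalDomain.measure_set_eq (G := AddSubgroup.zmultiples (2 * Real.pi))
      (isAddFundamentalDomain_Ioc hT a σ) (isAddFundamentalDomain_Ioc hT b σ)
      ((pp_cont hK).measurable hS)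
    rintro ⟨c, hcm⟩
    obtain ⟨n, rfl⟩ := AddSubgroup.mem_zmultiples_iff.1 hcm
    ext x
    simp only [mem_preimage, AddSubgroup.vadd_def, vadd_eq_add]
    rw [zsmul_eq_mul, add_comm, pp_int]
  let μ : Measure Plane := Measure.map (pp K) (σ.restrict (Ioc 0 (0 + 2 * Real.pi)))
  have μS : ∀ (S : Set Plane) (a : ℝ), MeasurableSet S →
      μ S = σ (pp K ⁻¹' S ∩ Ioc a (a + 2 * Real.pi)) := by
    intro S a hS
    rw [window a 0 S hS]
    show Measure.map _ _ S = _
    rw [Measure.map_apply (pp_cont hK).measurable hS,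
      Measure.restrict_apply ((pp_cont hK).measurable hS)]
  have μarc : ∀ s t, s < t → t < s + Real.pi →
      μ (pp K '' Icc s t) = ENNReal.ofReal (F t - F s) := by
    intro s t h1 h2
    rw [μS _ (s - Real.pi) (arc_compact hK s t).isClosed.measurableSet, ← σIcc]
    congr 1
    ext x
    constructor
    · rintro ⟨⟨w, hw, hwx⟩, hx⟩
      have : w = x := pp_inj' hK hwx (by linarith [hw.1, hw.2, hx.1, hx.2])
        (by linarith [hw.1, hw.2, hx.1, hx.2])
      rw [← this]; exact hw
    · intro hx
      exact ⟨⟨x, hx, rfl⟩, by linarith [hx.1], by linarith [hx.2]⟩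
  have hfm : MeasurableSet (frontier K) := isClosed_frontier.measurableSet
  have hneg : Measure.map (MeasurableEquiv.neg Plane) μ = μ := by
    ext S hS
    rw [MeasurableEquiv.map_apply]
    rw [μS _ 0 ((MeasurableEquiv.neg Plane).measurable hS), μS S Real.pi hS,
      ← σinv 1 _ (((pp_cont hK).measurable hS).inter measurableSet_Ioc)]
    congr 1
    ext x
    simp only [mem_inter_iff, mem_preimage, MeasurableEquiv.neg_apply, Int.cast_one, one_mul,
      pp_pi hK, mem_Ioc]
    refine and_congr_right fun _ => ⟨fun h => ⟨by linarith [h.1], by linarith [h.2]⟩,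
      fun h => ⟨by linarith [h.1], by linarith [h.2]⟩⟩
  refine ⟨μ, ⟨?_, ?_, ?_, ?_⟩, ?_⟩
  · rw [μS _ 0 hfm]
    have : pp K ⁻¹' frontier K = univ := by
      ext x; simp [pp_front hK x]
    rw [this, univ_inter, σIoc]
    congr 1
    have := shift_int F hp 0 2
    push_cast at this
    rw [this]; ring
  · rw [μS _ 0 hfm.compl]
    have : pp K ⁻¹' (frontier K)ᶜ = ∅ := by
      ext x; simp [pp_front hK x]
    rw [this, empty_inter, measure_empty]
  · intro X
    conv_rhs => rw [← hneg]
    rw [MeasurableEquiv.map_apply]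
    rfl
  · intro x
    rw [μS _ 0 (measurableSet_singleton x)]
    have hsub : (pp K ⁻¹' {x} ∩ Ioc 0 (0 + 2 * Real.pi)).Subsingleton := by
      intro a ha b hb
      have hab : pp K a = pp K b := ha.1.trans hb.1.symm
      exact pp_inj' hK hab (by linarith [ha.2.1, ha.2.2, hb.2.1, hb.2.2])
        (by linarith [ha.2.1, ha.2.2, hb.2.1, hb.2.2])
    rcases hsub.eq_empty_or_singleton with h | ⟨a, h⟩
    · rw [h, measure_empty]
    · rw [h, σ0]
  · intro C x y hC hxy
    obtain ⟨s, -, -, rfl⟩ := polar_front hK (hC.1 hC.2.2.2.1) 0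
    obtain ⟨t, t1, t2, rfl⟩ := polar_front hK (hC.1 hC.2.2.2.2.1) (s - Real.pi)
    have hne := BOrth_D_ne hK hxy
    rcases lt_trichotomy s t with h | h | h
    · rcases (show t ≤ s + Real.pi by linarith).lt_or_eq with h' | h'
      · rw [arc_eq hK h h' hC, μarc s t h h', hR s t ((RR_iff hK h h').2 hxy)]
        congr 1; ring
      · rw [h', pp_pi hK, DD_neg_right, DD_self] at hne
        simp at hne
    · rw [h, DD_self] at hne; exact absurd rfl hne
    · have h' : s < t + Real.pi := by linarith
      rw [arc_eq hK h h' hC.swap, μarc t s h h']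
      have := hR s (t + Real.pi) ((RR_iff hK h' (by linarith)).2 (by
        rw [pp_pi hK]; exact BOrth_neg_right hxy))
      rw [hp] at this
      congr 1; linarith

lemma absB_shift {K : Set Plane} (hK : IsSymmConvexBody K) (x : ℝ) :
    x ∈ absB (RR K) ↔ x + Real.pi ∈ absB (RR K) := by
  have sh := RR_shift hK
  have sh' : ∀ s t, RR K (s - Real.pi) (t - Real.pi) ↔ RR K s t := by
    intro s t
    rw [sh]; simp
  simp only [absB, mem_ofPred_eq]
  refine and_congr ⟨?_, ?_⟩ (not_congr ⟨?_, ?_⟩)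
  · rintro ⟨t, a, b⟩
    exact ⟨t + Real.pi, (sh _ _).1 a, (sh _ _).1 b⟩
  · rintro ⟨t, a, b⟩
    refine ⟨t - Real.pi, ?_, ?_⟩
    · rw [sh]; simpa using a
    · rw [sh]; simpa using b
  · rintro ⟨s₁, s₂, t, a, b, c, d⟩
    exact ⟨s₁ + Real.pi, s₂ + Real.pi, t + Real.pi, by linarith, by linarith,
      (sh _ _).1 c, (sh _ _).1 d⟩
  · rintro ⟨s₁, s₂, t, a, b, c, d⟩
    exact ⟨s₁ - Real.pi, s₂ - Real.pi, t - Real.pi, by linarith, by linarith,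
      (sh' _ _).2 c, (sh' _ _).2 d⟩

/-- A B-measure exists on `∂K` iff `A(K) \ E(K)` is uncountable. -/
theorem stmt_4 (K : Set Plane) (hK : IsSymmConvexBody K) :
    (∃ μ : Measure Plane, IsBMeasure K μ) ↔
      ¬ (Auerbach K \ SegUnion K).Countable := by
  rw [← absB_countable hK]
  constructor
  · rintro ⟨μ, hμ⟩
    exact dir_fwd hK μ hμ
  · intro h
    obtain ⟨G, g1, g2, g3, g4⟩ := exists_G (absB (RR K)) (by
      intro x
      exact absB_shift hK x) h
    obtain ⟨F, f1, f2, f3, f4⟩ := abs_bwd (RR K) (RR_tot hK) (RR_tot' hK) (RR_mono hK)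
      (RR_shift hK) G g1 g2 g3 g4
    exact dir_bwd hK F f1 f2 f3 f4
end

section
/- There exists a smooth, strictly convex, origin-symmetric convex body K in ℝ² whose set of Auerbach points A(K) has one-dimensional Lebesgue (arc length) measure zero and is uncountable; consequently K admits a B-measure even though A(K) is a null set. -/
open Set MeasureTheory Pointwise

open Set MeasureTheory Pointwise

structure Dat (W Ψ : ℝ → ℝ) : Prop where
  bd : ∀ u, |W u| ≤ 1 / 10
  lip : ∀ u v, |W u - W v| ≤ |u - v| / 10
  der : ∀ u, HasDerivAt Ψ (-W u) u
  smooth : ContDiff ℝ (⊤ : ℕ∞) Ψ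
  zero : ∀ u, W u = 0 ↔ u ≤ 0 ∨ 1 / 2 ≤ u ∨ 2 * u ∈ cantorSet
  psi0 : Ψ 0 = 0

lemma volume_cantor : volume cantorSet = 0 := by
  have hfin : volume cantorSet ≠ ⊤ := isCompact_cantorSet.measure_lt_top.ne
  have h1 : volume ((· / 3) '' cantorSet) = ENNReal.ofReal (1/3) * volume cantorSet := by
    have := Measure.addHaar_image_homothety (volume : Measure ℝ) (0:ℝ) (1/3) cantorSet
    have e : (AffineMap.homothety (0:ℝ) (1/3:ℝ) : ℝ → ℝ) = (· / 3) := by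
      ext x; simp [AffineMap.homothety_apply]; ring
    rw [e] at this
    rw [this]; simp
  have h2 : volume ((fun x ↦ (2 + x) / 3) '' cantorSet)
      = ENNReal.ofReal (1/3) * volume cantorSet := by
    have := Measure.addHaar_image_homothety (volume : Measure ℝ) (1:ℝ) (1/3) cantorSet
    have e : (AffineMap.homothety (1:ℝ) (1/3:ℝ) : ℝ → ℝ) = (fun x ↦ (2 + x) / 3) := by
      ext x; simp [AffineMap.homothety_apply]; ring
    rw [e] at this
    rw [this]; simp
  have h3 : volume cantorSet ≤ ENNReal.ofReal (1/3) * volume cantorSet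
      + ENNReal.ofReal (1/3) * volume cantorSet := by
    conv_lhs => rw [cantorSet_eq_union_halves]
    refine (measure_union_le _ _).trans ?_
    rw [h1, h2]
  lift volume cantorSet to NNReal using hfin with r hr
  have h4 : (r:ℝ) ≤ 1/3 * r + 1/3 * r := by
    have := ENNReal.toReal_mono (by finiteness) h3
    rw [ENNReal.toReal_add (by finiteness) (by finiteness), ENNReal.toReal_mul,
      ENNReal.toReal_ofReal (by norm_num)] at this
    simpa using this
  have : r = 0 := by
    have := r.2
    apply NNReal.eq
    simp only [NNReal.coe_zero]
    change (0:ℝ) ≤ (r:ℝ) at this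
    linarith
  simp [this]

lemma cantor_uncountable : ¬ Countable cantorSet := by
  intro h
  have : Countable (ℕ → Bool) := cantorSetEquivNatToBool.symm.injective.countable
  have h2 : Countable (Set ℕ) := by
    refine Function.Injective.countable (f := fun s : Set ℕ => (fun n => @decide (n ∈ s) (Classical.dec _) : ℕ → Bool)) ?_
    intro s t hst
    ext n
    have := congrFun hst n
    simpa using this
  have h3 := Cardinal.mk_le_aleph0_iff.2 h2
  rw [Cardinal.mk_set, Cardinal.mk_nat] at h3
  exact absurd h3 (not_le.2 (Cardinal.cantor _))

lemma exists_dat : ∃ W Ψ : ℝ → ℝ, Dat W Ψ := by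
  have hU : IsOpen (Ioo (0:ℝ) (1/2) \ (fun u => 2 * u) ⁻¹' cantorSet) :=
    isOpen_Ioo.sdiff (isClosed_cantorSet.preimage (by fun_prop))
  obtain ⟨f, hs, hf, hr⟩ := hU.exists_contDiff_support_eq (n := (⊤ : ℕ∞))
  have hc : HasCompactSupport f := by
    refine HasCompactSupport.intro (K := Icc 0 (1/2)) isCompact_Icc ?_
    intro x hx
    by_contra h
    have : x ∈ Function.support f := h
    rw [hs] at this
    exact hx ⟨this.1.1.le, this.1.2.le⟩
  obtain ⟨C, hC⟩ := ContDiff.lipschitzWith_of_hasCompactSupport hc hf (by simp)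
  set ε : ℝ := 1 / (10 * (1 + C)) with hε
  have hC0 : (0:ℝ) ≤ C := C.2
  have hεpos : 0 < ε := by positivity
  have hε1 : ε ≤ 1/10 := by
    rw [hε, div_le_div_iff₀ (by positivity) (by norm_num)]; linarith
  have hε2 : ε * C ≤ 1/10 := by
    rw [hε, div_mul_eq_mul_div, div_le_div_iff₀ (by positivity) (by norm_num)]; linarith
  have hWs : ContDiff ℝ (⊤ : ℕ∞) (fun u => ε * f u) := contDiff_const.mul hf
  have hder : ∀ u, HasDerivAt (fun u => - ∫ t in (0:ℝ)..u, ε * f t) (-(ε * f u)) u := by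
    intro u
    exact (hWs.continuous.integral_hasStrictDerivAt 0 u).hasDerivAt.neg
  refine ⟨fun u => ε * f u, fun u => - ∫ t in (0:ℝ)..u, ε * f t, ?_, ?_, hder, ?_, ?_, by simp⟩
  · intro u
    have := hr (mem_range_self u)
    rw [abs_of_nonneg (mul_nonneg hεpos.le this.1)]
    nlinarith [this.1, this.2]
  · intro u v
    have := hC.dist_le_mul u v
    rw [Real.dist_eq, Real.dist_eq] at this
    rw [← mul_sub, abs_mul, abs_of_pos hεpos]
    have h2 : ε * |f u - f v| ≤ ε * (C * |u - v|) := by gcongr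
    nlinarith [abs_nonneg (u - v)]
  · rw [contDiff_infty_iff_deriv]
    refine ⟨fun u => (hder u).differentiableAt, ?_⟩
    rw [show deriv (fun u => - ∫ t in (0:ℝ)..u, ε * f t) = fun u => -(ε * f u) from
      funext fun u => (hder u).deriv]
    exact hWs.neg
  · intro u
    have h1 : ε * f u = 0 ↔ u ∉ Function.support f := by simp [hεpos.ne']
    rw [h1, hs]
    simp only [mem_diff, mem_Ioo, mem_preimage]
    grind

open Set MeasureTheory Pointwise

def qd (x : Plane) : ℝ := x.1 ^ 2 + x.2 ^ 2
def ip (x v : Plane) : ℝ := x.1 * v.1 + x.2 * v.2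
def dt (x v : Plane) : ℝ := x.1 * v.2 - x.2 * v.1
noncomputable def pr (x : Plane) : ℝ := x.1 ^ 2 / qd x
noncomputable def al (W : ℝ → ℝ) (x : Plane) : ℝ := W (pr x) * (x.1 * x.2 / qd x)
noncomputable def nm (Ψ : ℝ → ℝ) (x : Plane) : ℝ := √(qd x) * Real.exp (Ψ (pr x) / 2)
noncomputable def lam (W Ψ : ℝ → ℝ) (x v : Plane) : ℝ :=
  Real.exp (Ψ (pr x) / 2) * (ip x v + al W x * dt x v) / √(qd x)
def rot (x : Plane) : Plane := (-x.2, x.1)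

lemma qd_pos {x : Plane} (hx : x ≠ 0) : 0 < qd x := by
  unfold qd
  by_contra h
  apply hx
  have h1 : x.1 = 0 := by nlinarith [sq_nonneg x.1, sq_nonneg x.2]
  have h2 : x.2 = 0 := by nlinarith [sq_nonneg x.1, sq_nonneg x.2]
  exact Prod.ext h1 h2

lemma qd_nonneg (x : Plane) : 0 ≤ qd x := by unfold qd; positivity

lemma ip_dt (x v : Plane) : ip x v ^ 2 + dt x v ^ 2 = qd x * qd v := by
  unfold ip dt qd; ring

lemma Dat.taylor {W Ψ : ℝ → ℝ} (h : Dat W Ψ) (a b : ℝ) :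
    -W a * (b - a) - (b - a) ^ 2 / 10 ≤ Ψ b - Ψ a := by
  have hd : Differentiable ℝ Ψ := fun u => (h.der u).differentiableAt
  have key : ∃ ξ, |ξ - a| ≤ |b - a| ∧ Ψ b - Ψ a = -W ξ * (b - a) := by
    rcases lt_trichotomy a b with hab | hab | hab
    · obtain ⟨ξ, hξ, he⟩ := exists_hasDerivAt_eq_slope Ψ (fun u => -W u) hab
        hd.continuous.continuousOn (fun u _ => h.der u)
      refine ⟨ξ, ?_, ?_⟩
      · rw [abs_of_pos (by linarith [hξ.1]), abs_of_pos (by linarith)]; linarith [hξ.2]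
      · rw [he]; field_simp [sub_ne_zero.2 hab.ne']
    · subst hab; exact ⟨a, by simp⟩
    · obtain ⟨ξ, hξ, he⟩ := exists_hasDerivAt_eq_slope Ψ (fun u => -W u) hab
        hd.continuous.continuousOn (fun u _ => h.der u)
      refine ⟨ξ, ?_, ?_⟩
      · rw [abs_of_neg (by linarith [hξ.2]), abs_of_neg (by linarith)]; linarith [hξ.1]
      · rw [he]
        have : a - b ≠ 0 := sub_ne_zero.2 hab.ne'
        field_simp; ring
  obtain ⟨ξ, h1, h2⟩ := key
  rw [h2]
  have h3 := h.lip ξ a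
  have h4 : |(W ξ - W a) * (b - a)| ≤ (b - a) ^ 2 / 10 := by
    rw [abs_mul, ← sq_abs (b - a)]
    nlinarith [abs_nonneg (b - a), abs_nonneg (W ξ - W a)]
  have := (abs_le.1 h4).2
  linarith

lemma Dat.unit {W Ψ : ℝ → ℝ} (h : Dat W Ψ) (X1 X2 c D : ℝ) (hX : X1 ^ 2 + X2 ^ 2 = 1)
    (hc : c ^ 2 + D ^ 2 = 1) :
    c + W (X1 ^ 2) * (X1 * X2) * D + (1 - c) / 2 ≤
      Real.exp ((Ψ ((c * X1 - D * X2) ^ 2) - Ψ (X1 ^ 2)) / 2) := by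
  have ht := h.taylor (X1 ^ 2) ((c * X1 - D * X2) ^ 2)
  set w := W (X1 ^ 2) with hw
  have hb := abs_le.1 (h.bd (X1 ^ 2))
  rw [← hw] at hb
  set Δ := (c * X1 - D * X2) ^ 2 - X1 ^ 2 with hΔ
  set S := 2 * c * (X1 * X2) + D * (X1 ^ 2 - X2 ^ 2) with hS
  have e1 : Δ = - D * S := by
    have : c ^ 2 = 1 - D ^ 2 := by linarith
    have : Δ = (c ^ 2 - 1) * X1 ^ 2 - 2 * c * D * X1 * X2 + D ^ 2 * X2 ^ 2 := by rw [hΔ]; ring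
    rw [this, hS, show c ^ 2 - 1 = - D ^ 2 by linarith]; ring
  have hS1 : S ^ 2 ≤ 1 := by
    have h1 : (2 * (X1 * X2)) ^ 2 + (X1 ^ 2 - X2 ^ 2) ^ 2 = 1 := by
      have : (2 * (X1 * X2)) ^ 2 + (X1 ^ 2 - X2 ^ 2) ^ 2 = (X1 ^ 2 + X2 ^ 2) ^ 2 := by ring
      rw [this, hX]; norm_num
    have h2 : S ^ 2 + (c * (X1 ^ 2 - X2 ^ 2) - D * (2 * (X1 * X2))) ^ 2
        = (c ^ 2 + D ^ 2) * ((2 * (X1 * X2)) ^ 2 + (X1 ^ 2 - X2 ^ 2) ^ 2) := by rw [hS]; ring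
    rw [hc, h1] at h2
    nlinarith [sq_nonneg (c * (X1 ^ 2 - X2 ^ 2) - D * (2 * (X1 * X2)))]
  have hΔ2 : Δ ^ 2 ≤ D ^ 2 := by
    rw [e1, mul_pow, neg_sq]; nlinarith [sq_nonneg D]
  have hexp := Real.add_one_le_exp ((Ψ ((c * X1 - D * X2) ^ 2) - Ψ (X1 ^ 2)) / 2)
  refine le_trans ?_ hexp
  have hc1 : c ≤ 1 := by nlinarith [sq_nonneg D]
  have hD : D ^ 2 ≤ 2 * (1 - c) := by nlinarith
  have hDa : |D| ≤ 1 := by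
    rw [← sq_le_one_iff_abs_le_one]; nlinarith [sq_nonneg c]
  have hx12 : |X1 * X2| ≤ 1 := by
    rw [abs_le]; constructor <;> nlinarith [sq_nonneg (X1 - X2), sq_nonneg (X1 + X2)]
  have hx12' : |X1 ^ 2 - X2 ^ 2| ≤ 1 := by
    rw [abs_le]; constructor <;> nlinarith [sq_nonneg X1, sq_nonneg X2]
  have b1 : |w * (X1 * X2) * D| ≤ 1 / 10 := by
    rw [abs_mul, abs_mul]
    calc |w| * |X1 * X2| * |D| ≤ 1 / 10 * 1 * 1 := by gcongr; exact h.bd _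
      _ = _ := by norm_num
  have b2 : |w * (X1 ^ 2 - X2 ^ 2)| ≤ 1 / 10 := by
    rw [abs_mul]
    calc |w| * |X1 ^ 2 - X2 ^ 2| ≤ 1 / 10 * 1 := by gcongr; exact h.bd _
      _ = _ := by norm_num
  have e2 : -w * Δ = 2 * c * (w * (X1 * X2) * D) + D ^ 2 * (w * (X1 ^ 2 - X2 ^ 2)) := by
    rw [e1, hS]; ring
  have b1' := (abs_le.1 b1)
  have b2' := (abs_le.1 b2)
  have b3 := mul_le_mul_of_nonneg_left b2'.1 (sq_nonneg D)
  have b4 := mul_le_mul_of_nonneg_left b1'.2 (sub_nonneg.2 hc1)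
  clear_value w Δ S
  have e3 : -w * Δ / 2 = c * (w * (X1 * X2) * D) + D ^ 2 * (w * (X1 ^ 2 - X2 ^ 2)) / 2 := by
    rw [e2]; ring
  have b5 : (w * (X1 * X2) * D) - c * (w * (X1 * X2) * D) ≤ (1 - c) * (1 / 10) := by linarith
  linarith

lemma Dat.gap {W Ψ : ℝ → ℝ} (h : Dat W Ψ) {x v : Plane} (hx : x ≠ 0) (hv : v ≠ 0) :
    Real.exp (Ψ (pr x) / 2) * (√(qd x) * √(qd v) - ip x v) / (2 * √(qd x))
      ≤ nm Ψ v - lam W Ψ x v := by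
  have hqx := qd_pos hx
  have hqv := qd_pos hv
  set r := √(qd x) with hr
  set s := √(qd v) with hs
  have hr0 : 0 < r := Real.sqrt_pos.2 hqx
  have hs0 : 0 < s := Real.sqrt_pos.2 hqv
  have hr2 : r ^ 2 = qd x := Real.sq_sqrt hqx.le
  have hs2 : s ^ 2 = qd v := Real.sq_sqrt hqv.le
  have key := h.unit (x.1 / r) (x.2 / r) (ip x v / (r * s)) (dt x v / (r * s))
    (by rw [div_pow, div_pow, hr2, ← add_div]; exact div_self hqx.ne')
    (by rw [div_pow, div_pow, mul_pow, hr2, hs2, ← add_div, ip_dt]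
        exact div_self (mul_pos hqx hqv).ne')
  have e1 : (x.1 / r) ^ 2 = pr x := by rw [div_pow, hr2]; rfl
  have e2 : (ip x v / (r * s)) * (x.1 / r) - (dt x v / (r * s)) * (x.2 / r) = v.1 / s := by
    have : ip x v * x.1 - dt x v * x.2 = qd x * v.1 := by unfold ip dt qd; ring
    rw [← hr2] at this
    field_simp
    linarith
  have e3 : (v.1 / s) ^ 2 = pr v := by rw [div_pow, hs2]; rfl
  have e4 : W (pr x) * (x.1 / r * (x.2 / r)) = al W x := by
    unfold al; rw [← hr2]; field_simp
  rw [e2, e1, e3, e4] at key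
  have e5 : Real.exp (Ψ (pr v) / 2) = Real.exp (Ψ (pr x) / 2) *
      Real.exp ((Ψ (pr v) - Ψ (pr x)) / 2) := by rw [← Real.exp_add]; congr 1; ring
  have e6 : nm Ψ v = s * Real.exp (Ψ (pr x) / 2) * Real.exp ((Ψ (pr v) - Ψ (pr x)) / 2) := by
    unfold nm; rw [e5]; ring
  set E := Real.exp (Ψ (pr x) / 2) with hE
  have hE0 : 0 < E := Real.exp_pos _
  have h7 := mul_le_mul_of_nonneg_left key (mul_pos hs0 hE0).le
  rw [← e6] at h7
  have e8 : s * E * (ip x v / (r * s) + al W x * (dt x v / (r * s)) + (1 - ip x v / (r * s)) / 2)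
    = lam W Ψ x v + E * (r * s - ip x v) / (2 * r) := by
    unfold lam; rw [← hE, ← hr]; field_simp
  linarith

lemma ip_le (x v : Plane) : ip x v ≤ √(qd x) * √(qd v) := by
  rw [← Real.sqrt_mul (qd_nonneg x)]
  apply Real.le_sqrt_of_sq_le
  nlinarith [ip_dt x v, sq_nonneg (dt x v)]

lemma nm_zero (Ψ : ℝ → ℝ) : nm Ψ 0 = 0 := by simp [nm, qd]

lemma lam_zero (W Ψ : ℝ → ℝ) (x) : lam W Ψ x 0 = 0 := by simp [lam, ip, dt]

lemma nm_nonneg (Ψ : ℝ → ℝ) (x) : 0 ≤ nm Ψ x := by unfold nm; positivity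

lemma nm_pos (Ψ : ℝ → ℝ) {x} (hx : x ≠ 0) : 0 < nm Ψ x := by
  have := Real.sqrt_pos.2 (qd_pos hx)
  unfold nm; positivity

lemma Dat.lam_le {W Ψ : ℝ → ℝ} (h : Dat W Ψ) {x : Plane} (v : Plane) (hx : x ≠ 0) :
    lam W Ψ x v ≤ nm Ψ v := by
  by_cases hv : v = 0
  · rw [hv, lam_zero, nm_zero]
  have := h.gap hx hv
  have h2 : 0 ≤ Real.exp (Ψ (pr x) / 2) * (√(qd x) * √(qd v) - ip x v) / (2 * √(qd x)) := by
    have := ip_le x v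
    have : 0 ≤ √(qd x) * √(qd v) - ip x v := by linarith
    positivity
  linarith

lemma dt_zero {x v : Plane} (hx : x ≠ 0) (h : dt x v = 0) : v = (ip x v / qd x) • x := by
  have hq := (qd_pos hx).ne'
  have h1 : qd x * v.1 = ip x v * x.1 - dt x v * x.2 := by unfold ip dt qd; ring
  have h2 : qd x * v.2 = ip x v * x.2 + dt x v * x.1 := by unfold ip dt qd; ring
  rw [h] at h1 h2
  refine Prod.ext ?_ ?_ <;> simp <;> field_simp <;> linarith

lemma Dat.lam_eq {W Ψ : ℝ → ℝ} (h : Dat W Ψ) {x v : Plane} (hx : x ≠ 0)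
    (he : lam W Ψ x v = nm Ψ v) : ∃ t : ℝ, 0 ≤ t ∧ v = t • x := by
  by_cases hv : v = 0
  · exact ⟨0, le_rfl, by simp [hv]⟩
  have h1 := h.gap hx hv
  rw [he, sub_self] at h1
  have hr := Real.sqrt_pos.2 (qd_pos hx)
  have hE := Real.exp_pos (Ψ (pr x) / 2)
  have h2 : ip x v = √(qd x) * √(qd v) := by
    refine le_antisymm (ip_le x v) ?_
    by_contra hlt
    have : 0 < √(qd x) * √(qd v) - ip x v := by linarith
    have : 0 < Real.exp (Ψ (pr x) / 2) * (√(qd x) * √(qd v) - ip x v) / (2 * √(qd x)) := by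
      positivity
    linarith
  have h3 : dt x v = 0 := by
    have := ip_dt x v
    rw [h2, mul_pow, Real.sq_sqrt (qd_nonneg x), Real.sq_sqrt (qd_nonneg v)] at this
    nlinarith
  refine ⟨_, ?_, dt_zero hx h3⟩
  rw [h2]; have := qd_nonneg x; positivity

lemma lam_self (W Ψ : ℝ → ℝ) {x : Plane} (hx : x ≠ 0) : lam W Ψ x x = nm Ψ x := by
  have h1 : ip x x = √(qd x) ^ 2 := by rw [Real.sq_sqrt (qd_nonneg x)]; unfold ip qd; ring
  have h2 : dt x x = 0 := by unfold dt; ring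
  have hr := Real.sqrt_pos.2 (qd_pos hx)
  unfold lam nm; rw [h1, h2]; field_simp; ring

lemma lam_add (W Ψ : ℝ → ℝ) (x a b : Plane) : lam W Ψ x (a + b) = lam W Ψ x a + lam W Ψ x b := by
  unfold lam ip dt; simp only [Prod.fst_add, Prod.snd_add]; ring

lemma lam_smul (W Ψ : ℝ → ℝ) (x a : Plane) (t : ℝ) : lam W Ψ x (t • a) = t * lam W Ψ x a := by
  unfold lam ip dt; simp only [Prod.smul_fst, Prod.smul_snd, smul_eq_mul]; ring

lemma qd_smul (t : ℝ) (x : Plane) : qd (t • x) = t ^ 2 * qd x := by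
  unfold qd; simp only [Prod.smul_fst, Prod.smul_snd, smul_eq_mul]; ring

lemma pr_smul {t : ℝ} (ht : t ≠ 0) (x : Plane) : pr (t • x) = pr x := by
  unfold pr; rw [qd_smul]; simp only [Prod.smul_fst, smul_eq_mul]
  rw [mul_pow, mul_div_mul_left _ _ (pow_ne_zero 2 ht)]

lemma al_smul (W : ℝ → ℝ) {t : ℝ} (ht : t ≠ 0) (x : Plane) : al W (t • x) = al W x := by
  unfold al; rw [pr_smul ht, qd_smul]; simp only [Prod.smul_fst, Prod.smul_snd, smul_eq_mul]
  rw [show t * x.1 * (t * x.2) = t ^ 2 * (x.1 * x.2) by ring,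
    mul_div_mul_left _ _ (pow_ne_zero 2 ht)]

lemma nm_smul (Ψ : ℝ → ℝ) (t : ℝ) (x : Plane) : nm Ψ (t • x) = |t| * nm Ψ x := by
  by_cases ht : t = 0
  · simp [ht, nm_zero]
  unfold nm; rw [pr_smul ht, qd_smul, Real.sqrt_mul (sq_nonneg t), Real.sqrt_sq_eq_abs]; ring

lemma Dat.nm_add {W Ψ : ℝ → ℝ} (h : Dat W Ψ) (a b : Plane) :
    nm Ψ (a + b) ≤ nm Ψ a + nm Ψ b := by
  by_cases hab : a + b = 0
  · rw [hab, nm_zero]; linarith [nm_nonneg Ψ a, nm_nonneg Ψ b]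
  rw [← lam_self W Ψ hab, lam_add]
  exact add_le_add (h.lam_le a hab) (h.lam_le b hab)

lemma al_lip {W Ψ : ℝ → ℝ} (h : Dat W Ψ) {x v : Plane} (hx : x ≠ 0) (hv : v ≠ 0) :
    |al W x - al W v| * |ip x v| ≤ |dt x v| / 5 := by
  have hqx := qd_pos hx
  have hqv := qd_pos hv
  set r := √(qd x) with hr
  set s := √(qd v) with hs
  have hr0 : 0 < r := Real.sqrt_pos.2 hqx
  have hs0 : 0 < s := Real.sqrt_pos.2 hqv
  have hr2 : r ^ 2 = qd x := Real.sq_sqrt hqx.le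
  have hs2 : s ^ 2 = qd v := Real.sq_sqrt hqv.le
  have hrs : 0 < r * s := by positivity
  have q1 : qd x = x.1 ^ 2 + x.2 ^ 2 := rfl
  have q2 : qd v = v.1 ^ 2 + v.2 ^ 2 := rfl
  have c1 : |x.1 * v.2 + v.1 * x.2| ≤ r * s := by
    apply abs_le_of_sq_le_sq _ hrs.le
    rw [mul_pow, hr2, hs2, q1, q2]
    nlinarith [sq_nonneg (x.1 * v.1 - x.2 * v.2)]
  have c2 : |x.2 * v.2 - x.1 * v.1| ≤ r * s := by
    apply abs_le_of_sq_le_sq _ hrs.le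
    rw [mul_pow, hr2, hs2, q1, q2]
    nlinarith [sq_nonneg (x.1 * v.2 + x.2 * v.1)]
  have c3 : |ip x v| ≤ r * s := by
    apply abs_le_of_sq_le_sq _ hrs.le
    rw [mul_pow, hr2, hs2, ← ip_dt]
    nlinarith [sq_nonneg (dt x v)]
  have c4 : |x.1 * x.2 / qd x| ≤ 1 := by
    rw [abs_div, abs_of_pos hqx, div_le_one hqx, abs_le, q1]
    constructor <;> nlinarith [sq_nonneg (x.1 - x.2), sq_nonneg (x.1 + x.2)]
  have d1 : |pr x - pr v| ≤ |dt x v| / (r * s) := by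
    have : pr x - pr v = dt x v * (x.1 * v.2 + v.1 * x.2) / (r * s) ^ 2 := by
      rw [mul_pow, hr2, hs2]; unfold pr; field_simp; rw [q1, q2]; unfold dt; ring
    rw [this, abs_div, abs_mul, abs_of_pos (pow_pos hrs 2), div_le_div_iff₀ (pow_pos hrs 2) hrs]
    have := mul_le_mul_of_nonneg_left c1 (mul_nonneg (abs_nonneg (dt x v)) hrs.le)
    linarith
  have d2 : |x.1 * x.2 / qd x - v.1 * v.2 / qd v| ≤ |dt x v| / (r * s) := by
    have : x.1 * x.2 / qd x - v.1 * v.2 / qd v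
        = dt x v * (x.2 * v.2 - x.1 * v.1) / (r * s) ^ 2 := by
      rw [mul_pow, hr2, hs2]; field_simp; rw [q1, q2]; unfold dt; ring
    rw [this, abs_div, abs_mul, abs_of_pos (pow_pos hrs 2), div_le_div_iff₀ (pow_pos hrs 2) hrs]
    have := mul_le_mul_of_nonneg_left c2 (mul_nonneg (abs_nonneg (dt x v)) hrs.le)
    linarith
  have d3 : |al W x - al W v| ≤ |dt x v| / (r * s) / 5 := by
    have : al W x - al W v = (W (pr x) - W (pr v)) * (x.1 * x.2 / qd x)
      + W (pr v) * (x.1 * x.2 / qd x - v.1 * v.2 / qd v) := by unfold al; ring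
    rw [this]
    refine (abs_add_le _ _).trans ?_
    rw [abs_mul, abs_mul]
    have f1 : |W (pr x) - W (pr v)| * |x.1 * x.2 / qd x| ≤ (|dt x v| / (r * s) / 10) * 1 := by
      gcongr
      exact (h.lip _ _).trans (by gcongr)
    have f2 : |W (pr v)| * |x.1 * x.2 / qd x - v.1 * v.2 / qd v|
        ≤ 1 / 10 * (|dt x v| / (r * s)) := by
      gcongr; exact h.bd _
    linarith
  calc _ ≤ |dt x v| / (r * s) / 5 * (r * s) := by gcongr
    _ = _ := by field_simp

open Set MeasureTheory Pointwise Topology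

lemma pr_nonneg (x : Plane) : 0 ≤ pr x := by
  unfold pr; have := qd_nonneg x; positivity

lemma pr_le_one (x : Plane) : pr x ≤ 1 := by
  unfold pr
  apply div_le_one_of_le₀ _ (qd_nonneg x)
  unfold qd; nlinarith [sq_nonneg x.2]

lemma Dat.psi_bd {W Ψ : ℝ → ℝ} (h : Dat W Ψ) (x : Plane) : |Ψ (pr x)| ≤ 1 := by
  have h0 := pr_nonneg x
  have h1 := pr_le_one x
  have a := h.taylor 0 (pr x)
  have b := h.taylor (pr x) 0
  rw [h.psi0] at a b
  have c := abs_le.1 (h.bd 0)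
  have d := abs_le.1 (h.bd (pr x))
  rw [abs_le]
  constructor <;> nlinarith

lemma contDiff_qd : ContDiff ℝ (⊤ : ℕ∞) qd := by unfold qd; fun_prop

lemma Dat.contDiffAt_nm {W Ψ : ℝ → ℝ} (h : Dat W Ψ) {x : Plane} (hx : x ≠ 0) :
    ContDiffAt ℝ (⊤ : ℕ∞) (nm Ψ) x := by
  have hq := (qd_pos hx).ne'
  have h1 : ContDiffAt ℝ (⊤ : ℕ∞) qd x := contDiff_qd.contDiffAt
  have h2 : ContDiffAt ℝ (⊤ : ℕ∞) pr x := by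
    unfold pr
    exact ContDiffAt.div (by fun_prop) h1 hq
  unfold nm
  exact (h1.sqrt hq).mul (((h.smooth.contDiffAt.comp x h2).div_const 2).exp)

lemma Dat.nm_le {W Ψ : ℝ → ℝ} (h : Dat W Ψ) (x : Plane) : nm Ψ x ≤ √(qd x) * Real.exp 1 := by
  unfold nm
  gcongr
  have := abs_le.1 (h.psi_bd x)
  linarith

lemma Dat.le_nm {W Ψ : ℝ → ℝ} (h : Dat W Ψ) (x : Plane) : √(qd x) * Real.exp (-1) ≤ nm Ψ x := by
  unfold nm
  gcongr
  have := abs_le.1 (h.psi_bd x)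
  linarith

lemma Dat.cont_nm {W Ψ : ℝ → ℝ} (h : Dat W Ψ) : Continuous (nm Ψ) := by
  rw [continuous_iff_continuousAt]
  intro x
  by_cases hx : x = 0
  · subst hx
    have h1 : Filter.Tendsto (fun x : Plane => √(qd x) * Real.exp 1) (𝓝 0) (𝓝 0) := by
      have : Continuous (fun x : Plane => √(qd x) * Real.exp 1) := by
        have := contDiff_qd.continuous; fun_prop
      have := this.tendsto 0
      simpa [qd] using this
    unfold ContinuousAt
    rw [nm_zero]
    exact squeeze_zero (nm_nonneg Ψ) h.nm_le h1
  · exact (h.contDiffAt_nm hx).continuousAt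

def body (Ψ : ℝ → ℝ) : Set Plane := {x | nm Ψ x ≤ 1}

lemma Dat.gauge_body {W Ψ : ℝ → ℝ} (_h : Dat W Ψ) : gauge (body Ψ) = nm Ψ := by
  ext x
  have e : {r : ℝ | 0 < r ∧ x ∈ r • body Ψ} = {r : ℝ | 0 < r ∧ nm Ψ x ≤ r} := by
    ext r
    simp only [mem_ofPred_eq]
    refine and_congr_right fun hr => ?_
    rw [mem_smul_set_iff_inv_smul_mem₀ hr.ne']
    unfold body
    rw [mem_ofPred_eq, nm_smul, abs_of_pos (inv_pos.2 hr), inv_mul_le_iff₀ hr, mul_one]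
  unfold gauge
  rw [e]
  apply le_antisymm
  · apply le_of_forall_pos_le_add
    intro ε hε
    exact csInf_le ⟨0, fun r hr => hr.1.le⟩ ⟨by linarith [nm_nonneg Ψ x], by linarith⟩
  · exact le_csInf ⟨nm Ψ x + 1, by linarith [nm_nonneg Ψ x], by linarith⟩ fun r hr => hr.2

lemma Dat.convex_body {W Ψ : ℝ → ℝ} (h : Dat W Ψ) : Convex ℝ (body Ψ) := by
  intro a ha b hb s t hs ht hst
  unfold body at *
  simp only [mem_ofPred_eq] at *
  refine (h.nm_add _ _).trans ?_
  rw [nm_smul, nm_smul, abs_of_nonneg hs, abs_of_nonneg ht]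
  nlinarith

lemma Dat.body_nhds {W Ψ : ℝ → ℝ} (h : Dat W Ψ) : body Ψ ∈ 𝓝 (0 : Plane) := by
  have : {x | nm Ψ x < 1} ∈ 𝓝 (0 : Plane) :=
    (isOpen_lt h.cont_nm continuous_const).mem_nhds (by simp [nm_zero])
  exact Filter.mem_of_superset this fun x hx => (by simp only [body, mem_ofPred_eq] at *; exact hx.le)

lemma Dat.frontier_body {W Ψ : ℝ → ℝ} (h : Dat W Ψ) (x : Plane) :
    x ∈ frontier (body Ψ) ↔ nm Ψ x = 1 := by
  rw [← gauge_eq_one_iff_mem_frontier h.convex_body h.body_nhds, h.gauge_body]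

lemma Dat.interior_body {W Ψ : ℝ → ℝ} (h : Dat W Ψ) (x : Plane) :
    x ∈ interior (body Ψ) ↔ nm Ψ x < 1 := by
  rw [← gauge_lt_one_iff_mem_interior h.convex_body h.body_nhds, h.gauge_body]

lemma ne_zero_of_nm {Ψ : ℝ → ℝ} {x : Plane} (h : nm Ψ x = 1) : x ≠ 0 := by
  rintro rfl; rw [nm_zero] at h; norm_num at h

lemma Dat.symm_body {W Ψ : ℝ → ℝ} (h : Dat W Ψ) : IsSymmConvexBody (body Ψ) := by
  refine ⟨h.convex_body, ?_, ⟨0, (h.interior_body 0).2 (by simp [nm_zero])⟩, ?_⟩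
  · apply Metric.isCompact_of_isClosed_isBounded
    · exact isClosed_le h.cont_nm continuous_const
    · rw [isBounded_iff_forall_norm_le]
      refine ⟨Real.exp 1, fun x hx => ?_⟩
      have h1 : √(qd x) ≤ Real.exp 1 := by
        have h2 := (h.le_nm x).trans hx
        rw [Real.exp_neg] at h2
        have := Real.exp_pos 1
        field_simp at h2
        exact h2
      refine le_trans ?_ h1
      rw [Prod.norm_def]
      apply max_le <;> apply Real.abs_le_sqrt <;> unfold qd <;>
        nlinarith [sq_nonneg x.1, sq_nonneg x.2]
  · ext x
    simp only [body, mem_neg, mem_ofPred_eq]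
    rw [← neg_one_smul ℝ x, nm_smul]; simp

lemma Dat.strict {W Ψ : ℝ → ℝ} (h : Dat W Ψ) : ∀ a ∈ frontier (body Ψ), ∀ b ∈ frontier (body Ψ),
    a ≠ b → openSegment ℝ a b ⊆ interior (body Ψ) := by
  intro a ha b hb hab c hc
  rw [h.frontier_body] at ha hb
  rw [h.interior_body]
  obtain ⟨s, t, hs, ht, hst, rfl⟩ := hc
  by_cases h0 : s • a + t • b = 0
  · rw [h0, nm_zero]; norm_num
  set c := s • a + t • b with hc
  have e : nm Ψ c = s * lam W Ψ c a + t * lam W Ψ c b := by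
    rw [← lam_self W Ψ h0, ← lam_smul, ← lam_smul, ← lam_add]
  have h1 := h.lam_le a h0
  have h2 := h.lam_le b h0
  rw [ha] at h1
  rw [hb] at h2
  by_contra hge
  have h3 : lam W Ψ c a = nm Ψ a := by rw [ha]; nlinarith
  have h4 : lam W Ψ c b = nm Ψ b := by rw [hb]; nlinarith
  obtain ⟨p, hp, hp'⟩ := h.lam_eq h0 h3
  obtain ⟨q, hq, hq'⟩ := h.lam_eq h0 h4
  have e1 := ha
  have e2 := hb
  rw [hp', nm_smul, abs_of_nonneg hp] at e1
  rw [hq', nm_smul, abs_of_nonneg hq] at e2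
  have : p = q := mul_right_cancel₀ (nm_pos Ψ h0).ne' (e1.trans e2.symm)
  exact hab (by rw [hp', hq', this])

lemma Dat.contW {W Ψ : ℝ → ℝ} (h : Dat W Ψ) : Continuous W := by
  have : LipschitzWith (1/10) W := by
    apply LipschitzWith.of_dist_le_mul
    intro x y
    rw [Real.dist_eq, Real.dist_eq]
    refine (h.lip x y).trans (le_of_eq ?_)
    push_cast; ring
  exact this.continuous

lemma Dat.cont_lam {W Ψ : ℝ → ℝ} (h : Dat W Ψ) {x : Plane} (hx : x ≠ 0) (v : Plane) :
    ContinuousAt (fun z => lam W Ψ z v) x := by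
  have hq := (qd_pos hx)
  have h1 : ContinuousAt qd x := contDiff_qd.continuous.continuousAt
  have h2 : ContinuousAt pr x := by
    unfold pr
    exact ContinuousAt.div (by fun_prop) h1 hq.ne'
  have h3 : ContinuousAt (fun z => W (pr z)) x := h.contW.continuousAt.comp h2
  have h4 : ContinuousAt (fun z => Ψ (pr z)) x := h.smooth.continuous.continuousAt.comp h2
  have h5 : ContinuousAt (al W) x := by
    unfold al
    exact h3.mul (ContinuousAt.div (by fun_prop) h1 hq.ne')
  unfold lam
  refine ContinuousAt.div ?_ h1.sqrt (Real.sqrt_pos.2 hq).ne'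
  refine (h4.div_const 2).rexp.mul ?_
  unfold ip dt
  fun_prop

lemma lam_zero_iff (W Ψ : ℝ → ℝ) {x : Plane} (hx : x ≠ 0) (v : Plane) :
    lam W Ψ x v = 0 ↔ ip x v + al W x * dt x v = 0 := by
  unfold lam
  have := (Real.sqrt_pos.2 (qd_pos hx)).ne'
  simp [this, Real.exp_ne_zero]

lemma Dat.borth {W Ψ : ℝ → ℝ} (h : Dat W Ψ) {x : Plane} (hx : x ≠ 0) (v : Plane) :
    BOrth (body Ψ) x v ↔ ip x v + al W x * dt x v = 0 := by
  rw [← lam_zero_iff W Ψ hx]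
  unfold BOrth
  rw [h.gauge_body]
  constructor
  · intro hb
    have hc : ContinuousAt (fun t : ℝ => lam W Ψ (x + t • v) v) 0 := by
      have h1 : ContinuousAt (fun z => lam W Ψ z v) (x + (0:ℝ) • v) := by
        simpa using h.cont_lam hx v
      exact ContinuousAt.comp (f := fun t : ℝ => x + t • v) (g := fun z => lam W Ψ z v) h1
        (by fun_prop)
    have hne : ∀ᶠ t : ℝ in 𝓝 0, x + t • v ≠ 0 := by
      have : ContinuousAt (fun t : ℝ => x + t • v) 0 := by fun_prop
      exact this.eventually_ne (by simpa using hx)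
    have key : ∀ᶠ t : ℝ in 𝓝 0, 0 ≤ t * lam W Ψ (x + t • v) v := by
      filter_upwards [hne] with t ht
      have h1 := hb t
      have h2 := h.lam_le x ht
      rw [← lam_self W Ψ ht, lam_add, lam_smul] at h1
      linarith
    have hc0 : Filter.Tendsto (fun t : ℝ => lam W Ψ (x + t • v) v) (𝓝 0) (𝓝 (lam W Ψ x v)) := by
      simpa [ContinuousAt] using hc
    apply le_antisymm
    · refine le_of_tendsto (hc0.mono_left (nhdsWithin_le_nhds (s := Iio 0))) ?_
      filter_upwards [nhdsWithin_le_nhds key, self_mem_nhdsWithin] with t ht ht0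
      exact nonpos_of_mul_nonneg_right ht ht0
    · refine ge_of_tendsto (hc0.mono_left (nhdsWithin_le_nhds (s := Ioi 0))) ?_
      filter_upwards [nhdsWithin_le_nhds key, self_mem_nhdsWithin] with t ht ht0
      exact nonneg_of_mul_nonneg_right ht ht0
  · intro h0 t
    have := h.lam_le (x + t • v) hx
    rw [lam_add, lam_smul, h0, lam_self W Ψ hx] at this
    linarith

lemma Dat.smooth_gauge {W Ψ : ℝ → ℝ} (h : Dat W Ψ) :
    ContDiffOn ℝ (⊤ : ℕ∞) (gauge (body Ψ)) {(0 : Plane)}ᶜ := by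
  rw [h.gauge_body]
  intro x hx
  exact (h.contDiffAt_nm hx).contDiffWithinAt

open Set MeasureTheory Pointwise Topology

lemma rot_ne {x : Plane} (hx : x ≠ 0) : rot x ≠ 0 := by
  intro h
  apply hx
  have h1 := congrArg Prod.fst h
  have h2 := congrArg Prod.snd h
  simp [rot] at h1 h2
  exact Prod.ext h2 h1

lemma qd_rot (x : Plane) : qd (rot x) = qd x := by simp [qd, rot]; ring

lemma pr_rot {x : Plane} (hx : x ≠ 0) : pr (rot x) = 1 - pr x := by
  have := (qd_pos hx).ne'
  unfold pr; rw [qd_rot]; field_simp; simp [rot, qd]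

lemma ip_rot_left (x v : Plane) : ip (rot x) v = dt x v := by simp [ip, dt, rot]; ring
lemma dt_rot_left (x v : Plane) : dt (rot x) v = - ip x v := by simp [ip, dt, rot]; ring
lemma ip_rot_right (x v : Plane) : ip x (rot v) = - dt x v := by simp [ip, dt, rot]; ring
lemma dt_rot_right (x v : Plane) : dt x (rot v) = ip x v := by simp [ip, dt, rot]
lemma dt_swap (x v : Plane) : dt v x = - dt x v := by simp [dt]; ring
lemma ip_swap (x v : Plane) : ip v x = ip x v := by simp [ip]; ring
lemma rot_rot (x : Plane) : rot (rot x) = - x := by simp [rot]; rfl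
lemma rot_smul (t : ℝ) (x : Plane) : rot (t • x) = t • rot x := by simp [rot]

lemma al_neg (W : ℝ → ℝ) (x : Plane) : al W (-x) = al W x := by
  rw [← neg_one_smul ℝ x, al_smul W (by norm_num)]

lemma Dat.al_zero {W Ψ : ℝ → ℝ} (h : Dat W Ψ) {x : Plane} (hx : 1 / 2 ≤ pr x) : al W x = 0 := by
  unfold al
  rw [(h.zero _).2 (Or.inr (Or.inl hx))]; simp

/-- either al x or al (rot x) vanishes -/
lemma Dat.al_or {W Ψ : ℝ → ℝ} (h : Dat W Ψ) {x : Plane} (hx : x ≠ 0) :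
    al W x = 0 ∨ al W (rot x) = 0 := by
  by_cases h1 : 1 / 2 ≤ pr x
  · exact Or.inl (h.al_zero h1)
  · refine Or.inr (h.al_zero ?_)
    rw [pr_rot hx]; linarith

lemma Dat.dt_ne {W Ψ : ℝ → ℝ} (_h : Dat W Ψ) {x y : Plane} (hx : x ≠ 0) (hy : y ≠ 0)
    (hb : ip x y + al W x * dt x y = 0) : dt x y ≠ 0 := by
  intro h0
  rw [h0] at hb
  have := ip_dt x y
  rw [h0, show ip x y = 0 by linarith] at this
  have := mul_pos (qd_pos hx) (qd_pos hy)
  linarith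

lemma Dat.auerbach {W Ψ : ℝ → ℝ} (h : Dat W Ψ) (x : Plane) :
    x ∈ Auerbach (body Ψ) ↔ nm Ψ x = 1 ∧ al W x = 0 ∧ al W (rot x) = 0 := by
  simp only [Auerbach, mem_ofPred_eq, h.frontier_body]
  refine and_congr_right fun hx1 => ?_
  have hx := ne_zero_of_nm hx1
  constructor
  · rintro ⟨y, hy1, h1, h2⟩
    have hy := ne_zero_of_nm hy1
    rw [h.borth hx] at h1
    rw [h.borth hy, ip_swap, dt_swap] at h2
    have hd := h.dt_ne hx hy h1
    have e : al W y = - al W x := by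
      have : (al W x + al W y) * dt x y = 0 := by linarith
      have := (mul_eq_zero.1 this).resolve_right hd
      linarith
    have hl := al_lip h (rot_ne hx) hy
    rw [ip_rot_left, dt_rot_left, abs_neg, show ip x y = - al W x * dt x y by linarith, abs_mul,
      abs_neg] at hl
    have hd' := abs_pos.2 hd
    have a0 : al W x = 0 := by
      rcases h.al_or hx with h3 | h3
      · exact h3
      · rw [h3, e, zero_sub, neg_neg] at hl
        by_contra hne
        have := mul_pos (abs_pos.2 hne) hd'
        linarith
    refine ⟨a0, ?_⟩
    rw [e, a0] at hl
    simp only [neg_zero, sub_zero, abs_zero, zero_mul, zero_div] at hl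
    by_contra hne
    have := mul_pos (abs_pos.2 hne) hd'
    linarith
  · rintro ⟨h1, h2⟩
    have hr := rot_ne hx
    have hn := nm_pos Ψ hr
    refine ⟨(nm Ψ (rot x))⁻¹ • rot x, ?_, ?_, ?_⟩
    · rw [nm_smul, abs_of_pos (inv_pos.2 hn)]; exact inv_mul_cancel₀ hn.ne'
    · rw [h.borth hx, h1]; simp [ip, rot]; ring
    · rw [h.borth (smul_ne_zero (inv_ne_zero hn.ne') hr), al_smul W (inv_ne_zero hn.ne'), h2]
      simp [ip, rot]; ring

noncomputable def rad (Ψ : ℝ → ℝ) (v : Plane) : Plane := (nm Ψ v)⁻¹ • v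

lemma nm_rad (Ψ : ℝ → ℝ) {v : Plane} (hv : v ≠ 0) : nm Ψ (rad Ψ v) = 1 := by
  have hn := nm_pos Ψ hv
  unfold rad
  rw [nm_smul, abs_of_pos (inv_pos.2 hn)]; exact inv_mul_cancel₀ hn.ne'

def zset : Set ℝ := {s | s ∈ Icc (-1) 1 ∧ 2 * (s ^ 2 / (1 + s ^ 2)) ∈ cantorSet}

lemma volume_zset : volume zset = 0 := by
  have h1 : zset ⊆ {0} ∪ ((fun c => √(c / (2 - c))) '' (cantorSet \ {0}) ∪
      (fun c => -√(c / (2 - c))) '' (cantorSet \ {0})) := by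
    rintro s ⟨hs, hc⟩
    by_cases h0 : s = 0
    · left; exact h0
    right
    have hs2 : 0 < s ^ 2 := by positivity
    have e : 2 * (s ^ 2 / (1 + s ^ 2)) / (2 - 2 * (s ^ 2 / (1 + s ^ 2))) = s ^ 2 := by
      have : 2 - 2 * (s ^ 2 / (1 + s ^ 2)) = 2 / (1 + s ^ 2) := by field_simp; ring
      rw [this]; field_simp
    have hne : 2 * (s ^ 2 / (1 + s ^ 2)) ∉ ({0} : Set ℝ) := by
      have : 0 < 2 * (s ^ 2 / (1 + s ^ 2)) := by positivity
      simpa using this.ne'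
    rcases le_total 0 s with hp | hp
    · left
      refine ⟨_, ⟨hc, hne⟩, ?_⟩
      simp only [e]; rw [Real.sqrt_sq hp]
    · right
      refine ⟨_, ⟨hc, hne⟩, ?_⟩
      simp only [e]; rw [Real.sqrt_sq_eq_abs, abs_of_nonpos hp]; ring
  have hd : DifferentiableOn ℝ (fun c : ℝ => √(c / (2 - c))) (cantorSet \ {0}) := by
    rintro c ⟨hc, hc0⟩
    have hc1 := cantorSet_subset_unitInterval hc
    have hc0' : c ≠ 0 := hc0
    have h2 : (2 - c) ≠ 0 := by linarith [hc1.2]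
    have : DifferentiableAt ℝ (fun c : ℝ => c / (2 - c)) c :=
      DifferentiableAt.div (by fun_prop) (by fun_prop) h2
    exact (this.sqrt (div_ne_zero hc0' h2)).differentiableWithinAt
  have hn : volume (cantorSet \ {0}) = 0 := measure_mono_null sdiff_subset volume_cantor
  refine measure_mono_null h1 ?_
  rw [measure_union_null_iff, measure_union_null_iff]
  refine ⟨by simp, ?_, ?_⟩
  · exact addHaar_image_eq_zero_of_differentiableOn_of_addHaar_eq_zero _ hd hn
  · exact addHaar_image_eq_zero_of_differentiableOn_of_addHaar_eq_zero _ hd.neg hn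

def sl (s : ℝ) : Plane := (s, 1)
lemma sl_ne (s : ℝ) : sl s ≠ 0 := by
  intro h; have := congrArg Prod.snd h; simp [sl] at this

lemma Dat.contDiffAt_rad {W Ψ : ℝ → ℝ} (h : Dat W Ψ) {x : Plane} (hx : x ≠ 0) :
    ContDiffAt ℝ (⊤ : ℕ∞) (rad Ψ) x := by
  unfold rad
  exact ((h.contDiffAt_nm hx).inv (nm_pos Ψ hx).ne').smul contDiffAt_id

lemma Dat.null_image {W Ψ : ℝ → ℝ} (h : Dat W Ψ) (g : ℝ → Plane) (hg : ContDiff ℝ (⊤ : ℕ∞) g)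
    (hg0 : ∀ s, g s ≠ 0) : μH[1] ((fun s => rad Ψ (g s)) '' zset) = 0 := by
  have hc : ContDiff ℝ (⊤ : ℕ∞) (fun s => rad Ψ (g s)) := by
    rw [contDiff_iff_contDiffAt]
    intro s
    exact (h.contDiffAt_rad (hg0 s)).comp s hg.contDiffAt
  obtain ⟨C, hC⟩ := hc.contDiffOn.exists_lipschitzOnWith (s := Icc (-1) 1) (by simp)
    (convex_Icc _ _) isCompact_Icc
  have hs : zset ⊆ Icc (-1) 1 := fun s hs => hs.1
  have := (hC.mono hs).hausdorffMeasure_image_le (d := 1) (by norm_num)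
  rw [hausdorffMeasure_real, volume_zset, mul_zero] at this
  exact le_antisymm this bot_le

lemma Dat.slope {W Ψ : ℝ → ℝ} (h : Dat W Ψ) {x : Plane} (hx : x ≠ 0) (ha : al W x = 0)
    (hp : pr x ≤ 1 / 2) : ∃ s ∈ zset, ∃ t : ℝ, t ≠ 0 ∧ x = t • sl s := by
  have hq := qd_pos hx
  have hx2 : x.2 ≠ 0 := by
    intro h0
    unfold pr at hp
    rw [div_le_iff₀ hq] at hp
    unfold qd at *
    rw [h0] at hp hq
    nlinarith
  have hle : x.1 ^ 2 ≤ x.2 ^ 2 := by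
    unfold pr at hp
    rw [div_le_iff₀ hq] at hp
    unfold qd at *
    nlinarith
  have e : (x.1 / x.2) ^ 2 / (1 + (x.1 / x.2) ^ 2) = pr x := by
    unfold pr qd; field_simp; rw [add_comm]
  refine ⟨x.1 / x.2, ⟨?_, ?_⟩, x.2, hx2, ?_⟩
  · rw [mem_Icc, ← abs_le, abs_div, div_le_one (abs_pos.2 hx2)]
    exact sq_le_sq.1 hle
  · rw [e]
    unfold al at ha
    rcases mul_eq_zero.1 ha with h1 | h1
    · rw [h.zero] at h1
      rcases h1 with h1 | h1 | h1
      · rw [le_antisymm h1 (pr_nonneg x), mul_zero]; exact zero_mem_cantorSet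
      · have : (1:ℝ) ∈ cantorSet := by
          have h3 : ∀ n, (1:ℝ) ∈ preCantorSet n := by
            intro n
            induction n with
            | zero => simp
            | succ n ih => exact Or.inr ⟨1, ih, by norm_num⟩
          simpa [cantorSet] using h3
        rw [le_antisymm hp h1]; norm_num; exact this
      · exact h1
    · have : x.1 = 0 := by
        rcases div_eq_zero_iff.1 h1 with h2 | h2
        · exact (mul_eq_zero.1 h2).resolve_right hx2
        · exact absurd h2 hq.ne'
      unfold pr; rw [this]; simpa using zero_mem_cantorSet
  · refine Prod.ext ?_ ?_ <;> simp [sl]; field_simp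

lemma rad_smul (Ψ : ℝ → ℝ) {t : ℝ} (ht : t ≠ 0) (v : Plane) :
    rad Ψ (t • v) = rad Ψ v ∨ rad Ψ (t • v) = rad Ψ (-v) := by
  unfold rad
  rw [← neg_one_smul ℝ v, nm_smul, nm_smul, smul_smul, smul_smul]
  rcases lt_or_gt_of_ne ht with h | h
  · right; congr 1; rw [abs_of_neg h]; field_simp; simp
  · left; congr 1; rw [abs_of_pos h]; field_simp

lemma rad_self {Ψ : ℝ → ℝ} {x : Plane} (hx : nm Ψ x = 1) : rad Ψ x = x := by
  unfold rad; rw [hx]; simp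

lemma Dat.auerbach_null {W Ψ : ℝ → ℝ} (h : Dat W Ψ) : μH[1] (Auerbach (body Ψ)) = 0 := by
  have hsub : Auerbach (body Ψ) ⊆
      ((fun s => rad Ψ (sl s)) '' zset ∪ (fun s => rad Ψ (- sl s)) '' zset) ∪
      ((fun s => rad Ψ (rot (sl s))) '' zset ∪ (fun s => rad Ψ (- rot (sl s))) '' zset) := by
    intro x hx
    rw [h.auerbach] at hx
    obtain ⟨h1, h2, h3⟩ := hx
    have hx0 := ne_zero_of_nm h1
    by_cases hp : pr x ≤ 1 / 2
    · left
      obtain ⟨s, hs, t, ht, rfl⟩ := h.slope hx0 h2 hp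
      rw [← rad_self h1]
      rcases rad_smul Ψ ht (sl s) with e | e
      · left; exact ⟨s, hs, e.symm⟩
      · right; exact ⟨s, hs, e.symm⟩
    · right
      obtain ⟨s, hs, t, ht, e0⟩ := h.slope (rot_ne hx0) h3 (by rw [pr_rot hx0]; linarith)
      have e1 : x = (-t) • rot (sl s) := by
        rw [← rot_smul, neg_smul, ← e0, ← neg_eq_iff_eq_neg.2 (rot_rot x)]
        simp [rot]
      rw [← rad_self h1, e1]
      rcases rad_smul Ψ (neg_ne_zero.2 ht) (rot (sl s)) with e | e
      · left; exact ⟨s, hs, e.symm⟩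
      · right; exact ⟨s, hs, e.symm⟩
  refine measure_mono_null hsub ?_
  simp only [measure_union_null_iff]
  have c1 : ContDiff ℝ (⊤ : ℕ∞) sl := by unfold sl; fun_prop
  have c2 : ContDiff ℝ (⊤ : ℕ∞) (fun s => rot (sl s)) := by unfold sl rot; fun_prop
  exact ⟨⟨h.null_image _ c1 sl_ne, h.null_image _ c1.neg fun s => neg_ne_zero.2 (sl_ne s)⟩,
    h.null_image _ c2 fun s => rot_ne (sl_ne s),
    h.null_image _ c2.neg fun s => neg_ne_zero.2 (rot_ne (sl_ne s))⟩

open Set MeasureTheory Pointwise Topology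

lemma Dat.exists_tau {W Ψ : ℝ → ℝ} (h : Dat W Ψ) : ∃ τ : ℝ → ℝ, Measurable τ ∧
    Function.Injective τ ∧ ∀ t, al W (sl (τ t)) = 0 ∧ al W (rot (sl (τ t))) = 0 := by
  have : StandardBorelSpace cantorSet := isClosed_cantorSet.measurableSet.standardBorel
  have hR : ¬ Countable ℝ := by
    rw [← uncountable_iff_not_countable]; infer_instance
  let e : ℝ ≃ᵐ cantorSet := PolishSpace.measurableEquivOfNotCountable hR cantor_uncountable
  have hc : ∀ t, 0 ≤ (e t : ℝ) ∧ (e t : ℝ) ≤ 1 := fun t => cantorSet_subset_unitInterval (e t).2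
  have hem : Measurable (fun t => (e t : ℝ)) := measurable_subtype_coe.comp e.measurable
  have hsq : ∀ t, √((e t : ℝ) / (2 - e t)) ^ 2 = (e t : ℝ) / (2 - e t) := fun t =>
    Real.sq_sqrt (div_nonneg (hc t).1 (by linarith [(hc t).2]))
  refine ⟨fun t => √((e t : ℝ) / (2 - e t)), ?_, ?_, ?_⟩
  · exact (hem.div (measurable_const.sub hem)).sqrt
  · intro t t' htt
    have h1 := congrArg (· ^ 2) htt
    simp only [hsq] at h1
    have a1 : 2 - (e t : ℝ) ≠ 0 := by linarith [(hc t).2]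
    have a2 : 2 - (e t' : ℝ) ≠ 0 := by linarith [(hc t').2]
    rw [div_eq_div_iff a1 a2] at h1
    apply e.injective
    apply Subtype.ext
    linarith
  · intro t
    have a1 : 0 < 2 - (e t : ℝ) := by linarith [(hc t).2]
    have hp : pr (sl √((e t : ℝ) / (2 - e t))) = (e t : ℝ) / 2 := by
      unfold pr qd sl
      simp only [hsq]
      have : (e t : ℝ) / (2 - e t) + 1 ^ 2 = 2 / (2 - e t) := by field_simp; ring
      rw [this]; field_simp
    constructor
    · unfold al
      rw [(h.zero _).2, zero_mul]
      right; right
      rw [hp, mul_div_cancel₀ _ (two_ne_zero)]; exact (e t).2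
    · apply h.al_zero
      rw [pr_rot (sl_ne _), hp]; linarith [(hc t).2]

lemma Dat.auerbach_unctbl {W Ψ : ℝ → ℝ} (h : Dat W Ψ) : ¬ (Auerbach (body Ψ)).Countable := by
  obtain ⟨τ, -, hi, ht⟩ := h.exists_tau
  intro hc
  have hinj : Function.Injective (fun t => rad Ψ (sl (τ t))) := by
    intro t t' htt
    apply hi
    have h1 := congrArg Prod.fst htt
    have h2 := congrArg Prod.snd htt
    simp only [rad, sl, Prod.smul_mk, smul_eq_mul, mul_one] at h1 h2
    rw [h2] at h1
    exact mul_left_cancel₀ (inv_ne_zero (nm_pos Ψ (sl_ne (τ t'))).ne') h1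
  have h2 : ((fun t => rad Ψ (sl (τ t))) ⁻¹' (Auerbach (body Ψ))).Countable :=
    hc.preimage hinj
  have h3 : (fun t => rad Ψ (sl (τ t))) ⁻¹' (Auerbach (body Ψ)) = univ := by
    apply eq_univ_of_forall
    intro t
    rw [mem_preimage, h.auerbach]
    have hn := inv_ne_zero (nm_pos Ψ (sl_ne (τ t))).ne'
    refine ⟨nm_rad Ψ (sl_ne _), ?_, ?_⟩
    · unfold rad; rw [al_smul W hn]; exact (ht t).1
    · unfold rad; rw [rot_smul, al_smul W hn]; exact (ht t).2
  rw [h3] at h2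
  exact not_countable_univ h2

lemma measurable_rot : Measurable rot := by unfold rot; fun_prop
lemma measurable_qd : Measurable qd := contDiff_qd.continuous.measurable
lemma measurable_pr : Measurable pr := by
  unfold pr; exact Measurable.div (by fun_prop) measurable_qd
lemma Dat.measurable_al {W Ψ : ℝ → ℝ} (h : Dat W Ψ) : Measurable (al W) := by
  unfold al
  exact (h.contW.measurable.comp measurable_pr).mul (Measurable.div (by fun_prop) measurable_qd)
lemma Dat.measurable_rad {W Ψ : ℝ → ℝ} (h : Dat W Ψ) : Measurable (rad Ψ) := by
  unfold rad
  exact h.cont_nm.measurable.inv.smul measurable_id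
lemma cont_dt (x : Plane) : Continuous (dt x) := by unfold dt; fun_prop
lemma cont_dt' (y : Plane) : Continuous (fun v => dt v y) := by unfold dt; fun_prop
lemma cont_ip (x : Plane) : Continuous (ip x) := by unfold ip; fun_prop

structure NuProp (W : ℝ → ℝ) (ν : Measure Plane) : Prop where
  inv : ν.map rot = ν
  tot : ν univ = ENNReal.ofReal (2 * Real.pi)
  good : ∀ᵐ v ∂ν, v ≠ 0 ∧ al W v = 0 ∧ al W (rot v) = 0
  line : ∀ x : Plane, x ≠ 0 → ∀ᵐ v ∂ν, dt x v ≠ 0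

lemma Dat.exists_nu {W Ψ : ℝ → ℝ} (h : Dat W Ψ) : ∃ ν : Measure Plane, NuProp W ν := by
  obtain ⟨τ, hm, hi, ht⟩ := h.exists_tau
  let m : Measure ℝ := ENNReal.ofReal (Real.pi / 2) • volume.restrict (Icc 0 1)
  have hmu : m univ = ENNReal.ofReal (Real.pi / 2) := by simp [m]
  have hms : ∀ t, m {t} = 0 := by intro t; simp [m]
  have : NullSingletonClass m := ⟨hms⟩
  have m0 : Measurable (fun t => sl (τ t)) := by unfold sl; fun_prop
  have m1 : Measurable (fun t => rot (sl (τ t))) := measurable_rot.comp m0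
  have m2 : Measurable (fun t => - sl (τ t)) := m0.neg
  have m3 : Measurable (fun t => - rot (sl (τ t))) := m1.neg
  have hae : ∀ P : Plane → Prop, MeasurableSet {v | P v} →
      (∀ᵐ t ∂m, P (sl (τ t))) → (∀ᵐ t ∂m, P (rot (sl (τ t)))) →
      (∀ᵐ t ∂m, P (- sl (τ t))) → (∀ᵐ t ∂m, P (- rot (sl (τ t)))) →
      ∀ᵐ v ∂(m.map (fun t => sl (τ t)) + m.map (fun t => rot (sl (τ t)))
        + m.map (fun t => - sl (τ t)) + m.map (fun t => - rot (sl (τ t)))), P v := by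
    intro P hP h0 h1 h2 h3
    rw [ae_add_measure_iff, ae_add_measure_iff, ae_add_measure_iff]
    exact ⟨⟨⟨(ae_map_iff m0.aemeasurable hP).2 h0, (ae_map_iff m1.aemeasurable hP).2 h1⟩,
      (ae_map_iff m2.aemeasurable hP).2 h2⟩, (ae_map_iff m3.aemeasurable hP).2 h3⟩
  refine ⟨_, ⟨?_, ?_, hae _ ?_ ?_ ?_ ?_ ?_, fun x hx => hae _ ?_ ?_ ?_ ?_ ?_⟩⟩
  · rw [Measure.map_add _ _ measurable_rot, Measure.map_add _ _ measurable_rot,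
      Measure.map_add _ _ measurable_rot,
      Measure.map_map measurable_rot m0, Measure.map_map measurable_rot m1,
      Measure.map_map measurable_rot m2, Measure.map_map measurable_rot m3]
    have e1 : rot ∘ (fun t => rot (sl (τ t))) = fun t => - sl (τ t) := by
      ext1 t; exact rot_rot _
    have e2 : rot ∘ (fun t => - sl (τ t)) = fun t => - rot (sl (τ t)) := by
      ext1 t; simp [rot]
    have e3 : rot ∘ (fun t => - rot (sl (τ t))) = fun t => sl (τ t) := by
      ext1 t; simp [rot]
    rw [e1, e2, e3]
    change _ + _ + _ + _ = _
    rw [show (rot ∘ fun t => sl (τ t)) = fun t => rot (sl (τ t)) from rfl]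
    abel
  · simp only [Measure.add_apply]
    rw [Measure.map_apply m0 .univ, Measure.map_apply m1 .univ, Measure.map_apply m2 .univ,
      Measure.map_apply m3 .univ]
    simp only [preimage_univ, hmu]
    have := Real.pi_pos
    rw [← ENNReal.ofReal_add (by positivity) (by positivity),
      ← ENNReal.ofReal_add (by positivity) (by positivity),
      ← ENNReal.ofReal_add (by positivity) (by positivity)]
    congr 1; ring
  · have a1 : MeasurableSet {v : Plane | v ≠ 0} := (measurableSet_singleton (0:Plane)).compl
    have a2 : MeasurableSet {v : Plane | al W v = 0} :=
      measurableSet_eq_fun h.measurable_al measurable_const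
    have a3 : MeasurableSet {v : Plane | al W (rot v) = 0} :=
      measurableSet_eq_fun (h.measurable_al.comp measurable_rot) measurable_const
    exact a1.inter (a2.inter a3)
  · exact .of_forall fun t => ⟨sl_ne _, (ht t).1, (ht t).2⟩
  · exact .of_forall fun t => ⟨rot_ne (sl_ne _), (ht t).2, by rw [rot_rot, al_neg]; exact (ht t).1⟩
  · exact .of_forall fun t => ⟨neg_ne_zero.2 (sl_ne _), by rw [al_neg]; exact (ht t).1, by
      rw [show rot (-sl (τ t)) = -rot (sl (τ t)) by simp [rot], al_neg]; exact (ht t).2⟩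
  · exact .of_forall fun t => ⟨neg_ne_zero.2 (rot_ne (sl_ne _)), by rw [al_neg]; exact (ht t).2, by
      rw [show rot (-rot (sl (τ t))) = sl (τ t) by simp [rot]]; exact (ht t).1⟩
  all_goals try exact (measurableSet_eq_fun (cont_dt x).measurable measurable_const).compl
  all_goals
    rw [ae_iff]
    refine Set.Subsingleton.measure_zero ?_ _
    intro t h1 t' h2
    apply hi
    simp only [dt, sl, rot, mem_ofPred_eq, not_not, ne_eq, Prod.fst_neg, Prod.snd_neg] at h1 h2
    by_contra hne
    apply hx
    have hne' := sub_ne_zero.2 hne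
    first
    | have e2 : x.2 = 0 := by
        have : x.2 * (τ t - τ t') = 0 := by linarith
        exact (mul_eq_zero.1 this).resolve_right hne'
      have e1 : x.1 = 0 := by rw [e2] at h1; linarith
      exact Prod.ext e1 e2
    | have e1 : x.1 = 0 := by
        have : x.1 * (τ t - τ t') = 0 := by linarith
        exact (mul_eq_zero.1 this).resolve_right hne'
      have e2 : x.2 = 0 := by rw [e1] at h1; linarith
      exact Prod.ext e1 e2

lemma quad {W : ℝ → ℝ} {ν : Measure Plane} (hν : NuProp W ν) {x : Plane} (hx : x ≠ 0) {d : ℝ}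
    (hd : d ≠ 0) : ν {v | 0 < ip x v ∧ 0 < d * dt x v} = ENNReal.ofReal (Real.pi / 2) := by
  have hr : ∀ s, MeasurableSet s → ν (rot ⁻¹' s) = ν s := by
    intro s hs
    rw [← Measure.map_apply measurable_rot hs, hν.inv]
  have mi := (cont_ip x).measurable
  have md := (cont_dt x).measurable
  have pp : MeasurableSet {v | 0 < ip x v} := measurableSet_lt measurable_const mi
  have pn : MeasurableSet {v | ip x v < 0} := measurableSet_lt mi measurable_const
  have dp : MeasurableSet {v | 0 < dt x v} := measurableSet_lt measurable_const md
  have dn : MeasurableSet {v | dt x v < 0} := measurableSet_lt md measurable_const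
  have A0 : MeasurableSet {v | 0 < ip x v ∧ 0 < dt x v} := pp.inter dp
  have A1 : MeasurableSet {v | 0 < ip x v ∧ dt x v < 0} := pp.inter dn
  have A2 : MeasurableSet {v | ip x v < 0 ∧ dt x v < 0} := pn.inter dn
  have A3 : MeasurableSet {v | ip x v < 0 ∧ 0 < dt x v} := pn.inter dp
  have r1 : ν {v | 0 < ip x v ∧ dt x v < 0} = ν {v | 0 < ip x v ∧ 0 < dt x v} := by
    rw [← hr _ A0]; congr 1; ext v
    simp only [mem_preimage, mem_ofPred_eq, ip_rot_right, dt_rot_right]; grind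
  have r2 : ν {v | ip x v < 0 ∧ dt x v < 0} = ν {v | 0 < ip x v ∧ dt x v < 0} := by
    rw [← hr _ A1]; congr 1; ext v
    simp only [mem_preimage, mem_ofPred_eq, ip_rot_right, dt_rot_right]; grind
  have r3 : ν {v | ip x v < 0 ∧ 0 < dt x v} = ν {v | ip x v < 0 ∧ dt x v < 0} := by
    rw [← hr _ A2]; congr 1; ext v
    simp only [mem_preimage, mem_ofPred_eq, ip_rot_right, dt_rot_right]; grind
  have hu : ν univ = ν ({v | 0 < ip x v ∧ 0 < dt x v} ∪ {v | 0 < ip x v ∧ dt x v < 0} ∪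
      {v | ip x v < 0 ∧ dt x v < 0} ∪ {v | ip x v < 0 ∧ 0 < dt x v}) := by
    apply measure_congr
    filter_upwards [hν.line x hx, hν.line (rot x) (rot_ne hx)] with v h1 h2
    rw [dt_rot_left] at h2
    have : v ∈ ({v | 0 < ip x v ∧ 0 < dt x v} ∪ {v | 0 < ip x v ∧ dt x v < 0} ∪
      {v | ip x v < 0 ∧ dt x v < 0} ∪ {v | ip x v < 0 ∧ 0 < dt x v}) := by
      simp only [mem_union, mem_ofPred_eq]; grind
    exact propext ⟨fun _ => this, fun _ => trivial⟩
  rw [measure_union _ A3, measure_union _ A2, measure_union _ A1, r3, r2, r1, hν.tot] at hu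
  rotate_left
  · rw [Set.disjoint_left]; intro v; simp only [mem_ofPred_eq]; grind
  · rw [Set.disjoint_left]; intro v; simp only [mem_union, mem_ofPred_eq]; grind
  · rw [Set.disjoint_left]; intro v; simp only [mem_union, mem_ofPred_eq]; grind
  have key : ν {v | 0 < ip x v ∧ 0 < dt x v} = ENNReal.ofReal (Real.pi / 2) := by
    have hfin : ν {v | 0 < ip x v ∧ 0 < dt x v} ≠ ⊤ := by
      intro htop; rw [htop] at hu; simp only [add_top] at hu
      exact ENNReal.ofReal_ne_top hu
    rw [← ENNReal.ofReal_toReal hfin] at hu ⊢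
    have hp := Real.pi_pos
    have hn : 0 ≤ (ν {v | 0 < ip x v ∧ 0 < dt x v}).toReal := ENNReal.toReal_nonneg
    rw [← ENNReal.ofReal_add (by positivity) (by positivity),
      ← ENNReal.ofReal_add (by positivity) (by positivity),
      ← ENNReal.ofReal_add (by positivity) (by positivity),
      ENNReal.ofReal_eq_ofReal_iff (by positivity) (by positivity)] at hu
    congr 1; linarith
  rcases lt_or_gt_of_ne hd with hd' | hd'
  · rw [← key, ← r1]; congr 1; ext v
    have : 0 < d * dt x v ↔ dt x v < 0 := by
      rw [mul_pos_iff]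
      constructor
      · rintro (a | a)
        · linarith
        · exact a.2
      · exact fun a => Or.inr ⟨hd', a⟩
    simp only [mem_ofPred_eq, this]
  · rw [← key]; congr 1; ext v
    simp only [mem_ofPred_eq, mul_pos_iff_of_pos_left hd']

def cone (x y : Plane) : Set Plane := {v | 0 ≤ dt x y * dt x v ∧ 0 ≤ dt x y * dt v y}

lemma Dat.cone_measure {W Ψ : ℝ → ℝ} (h : Dat W Ψ) {ν : Measure Plane} (hν : NuProp W ν)
    {x y : Plane} (hx : x ≠ 0) (hy : y ≠ 0) (hb : ip x y + al W x * dt x y = 0) :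
    ν (cone x y) = ENNReal.ofReal (Real.pi / 2) := by
  have hd := h.dt_ne hx hy hb
  rw [← quad hν hx hd]
  apply measure_congr
  filter_upwards [hν.good, hν.line x hx, hν.line (rot x) (rot_ne hx)] with v hg h1 h2
  rw [dt_rot_left, neg_ne_zero] at h2
  obtain ⟨hv, -, hv2⟩ := hg
  have hl := al_lip h hx (rot_ne hv)
  rw [hv2, sub_zero, ip_rot_right, dt_rot_right, abs_neg, ← abs_mul] at hl
  have hi := abs_pos.2 h2
  have hq := qd_pos hx
  have e : qd x * dt v y = dt x y * (ip x v + al W x * dt x v) := by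
    have : qd x * dt v y = dt x y * ip x v - ip x y * dt x v := by
      unfold qd dt ip; ring
    rw [this, show ip x y = - al W x * dt x y by linarith]; ring
  have hd2 : 0 < dt x y ^ 2 := by positivity
  have e2 : 0 ≤ dt x y * dt v y ↔ 0 ≤ ip x v + al W x * dt x v := by
    have e3 : qd x * (dt x y * dt v y) = dt x y ^ 2 * (ip x v + al W x * dt x v) := by
      rw [mul_left_comm, e]; ring
    rw [← mul_nonneg_iff_of_pos_left hq, e3, mul_nonneg_iff_of_pos_left hd2]
  have e4 : 0 ≤ ip x v + al W x * dt x v ↔ 0 < ip x v := by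
    have hl' := abs_le.1 hl
    rcases lt_or_gt_of_ne h2 with h3 | h3
    · rw [abs_of_neg h3] at hl'
      constructor <;> intro h4 <;> linarith
    · rw [abs_of_pos h3] at hl'
      constructor <;> intro h4 <;> linarith
  have e5 : 0 ≤ dt x y * dt x v ↔ 0 < dt x y * dt x v :=
    ⟨fun h => lt_of_le_of_ne h (mul_ne_zero hd h1).symm, le_of_lt⟩
  apply propext
  change (0 ≤ dt x y * dt x v ∧ 0 ≤ dt x y * dt v y) ↔ (0 < ip x v ∧ 0 < dt x y * dt x v)
  rw [e2, e4, e5]; tauto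

open Set MeasureTheory Pointwise Topology

lemma nm_neg' (Ψ : ℝ → ℝ) (x : Plane) : nm Ψ (-x) = nm Ψ x := by
  have := nm_smul Ψ (-1) x
  simpa using this

lemma rad_neg (Ψ : ℝ → ℝ) (x : Plane) : rad Ψ (-x) = - rad Ψ x := by
  unfold rad; rw [nm_neg', smul_neg]

/-- Two parallel unit vectors agree up to sign. -/
lemma par (Ψ : ℝ → ℝ) {x v : Plane} (hx : nm Ψ x = 1) (hv : nm Ψ v = 1) (h : dt x v = 0) :
    v = x ∨ v = -x := by
  have h1 := dt_zero (ne_zero_of_nm hx) h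
  have h2 : nm Ψ v = |ip x v / qd x| * nm Ψ x := by
    conv_lhs => rw [h1]
    exact nm_smul _ _ _
  rw [hv, hx, mul_one] at h2
  rcases (abs_eq zero_le_one).1 h2.symm with h3 | h3
  · left; rw [h3, one_smul] at h1; exact h1
  · right; rw [h3, neg_smul, one_smul] at h1; exact h1

lemma dt_self (x : Plane) : dt x x = 0 := by unfold dt; ring
lemma dt_neg_right (x v : Plane) : dt x (-v) = - dt x v := by
  unfold dt; simp only [Prod.fst_neg, Prod.snd_neg]; ring
lemma dt_neg_left (x v : Plane) : dt (-x) v = - dt x v := by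
  unfold dt; simp only [Prod.fst_neg, Prod.snd_neg]; ring
lemma dt_smul_right (t : ℝ) (x v : Plane) : dt x (t • v) = t * dt x v := by
  unfold dt; simp only [Prod.smul_fst, Prod.smul_snd, smul_eq_mul]; ring
lemma dt_smul_left (t : ℝ) (x v : Plane) : dt (t • x) v = t * dt x v := by
  unfold dt; simp only [Prod.smul_fst, Prod.smul_snd, smul_eq_mul]; ring

lemma cone_closed (x y : Plane) : IsClosed (cone x y) := by
  apply IsClosed.inter
  · exact isClosed_le continuous_const (continuous_const.mul (cont_dt x))
  · exact isClosed_le continuous_const (continuous_const.mul (cont_dt' y))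

lemma cone_smul {x y v : Plane} {t : ℝ} (ht : 0 < t) : t • v ∈ cone x y ↔ v ∈ cone x y := by
  change (0 ≤ dt x y * dt x (t • v) ∧ 0 ≤ dt x y * dt (t • v) y) ↔
    (0 ≤ dt x y * dt x v ∧ 0 ≤ dt x y * dt v y)
  rw [dt_smul_right, dt_smul_left, mul_left_comm, mul_left_comm (dt x y) t,
    mul_nonneg_iff_of_pos_left ht, mul_nonneg_iff_of_pos_left ht]

lemma left_mem_cone (x y : Plane) : x ∈ cone x y := by
  change (0 ≤ dt x y * dt x x ∧ 0 ≤ dt x y * dt x y)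
  rw [dt_self, mul_zero]; exact ⟨le_rfl, mul_self_nonneg _⟩
lemma right_mem_cone (x y : Plane) : y ∈ cone x y := by
  change (0 ≤ dt x y * dt x y ∧ 0 ≤ dt x y * dt y y)
  rw [dt_self, mul_zero]; exact ⟨mul_self_nonneg _, le_rfl⟩

lemma Dat.cone_conn {W Ψ : ℝ → ℝ} (h : Dat W Ψ) {x y : Plane} (hd : dt x y ≠ 0) :
    IsPreconnected (cone x y ∩ frontier (body Ψ)) := by
  have hseg : ∀ v ∈ segment ℝ x y, v ∈ cone x y ∧ v ≠ 0 := by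
    rintro v ⟨a, b, ha, hb, hab, rfl⟩
    have e1 : dt x (a • x + b • y) = b * dt x y := by
      unfold dt; simp only [Prod.smul_fst, Prod.smul_snd, smul_eq_mul, Prod.fst_add, Prod.snd_add]
      ring
    have e2 : dt (a • x + b • y) y = a * dt x y := by
      unfold dt; simp only [Prod.smul_fst, Prod.smul_snd, smul_eq_mul, Prod.fst_add, Prod.snd_add]
      ring
    constructor
    · change (0 ≤ dt x y * dt x _ ∧ 0 ≤ dt x y * dt _ y)
      rw [e1, e2]
      constructor
      · have := mul_nonneg hb (mul_self_nonneg (dt x y)); linarith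
      · have := mul_nonneg ha (mul_self_nonneg (dt x y)); linarith
    · intro h0
      rw [h0] at e1 e2
      have z1 : dt x 0 = 0 := by simp [dt]
      have z2 : dt 0 y = 0 := by simp [dt]
      rw [z1] at e1; rw [z2] at e2
      have b0 := (mul_eq_zero.1 e1.symm).resolve_right hd
      have a0 := (mul_eq_zero.1 e2.symm).resolve_right hd
      linarith
  have heq : cone x y ∩ frontier (body Ψ) = rad Ψ '' segment ℝ x y := by
    apply Subset.antisymm
    · rintro v ⟨⟨hv1, hv2⟩, hv⟩
      rw [h.frontier_body] at hv
      have hd2 : 0 < dt x y ^ 2 := by positivity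
      set a := dt v y / dt x y with ha
      set b := dt x v / dt x y with hb
      have ha0 : 0 ≤ a := by
        rw [ha, show dt v y / dt x y = dt x y * dt v y / dt x y ^ 2 by field_simp]
        exact div_nonneg hv2 hd2.le
      have hb0 : 0 ≤ b := by
        rw [hb, show dt x v / dt x y = dt x y * dt x v / dt x y ^ 2 by field_simp]
        exact div_nonneg hv1 hd2.le
      have e : v = a • x + b • y := by
        have e1 : dt x y * v.1 = dt v y * x.1 + dt x v * y.1 := by unfold dt; ring
        have e2 : dt x y * v.2 = dt v y * x.2 + dt x v * y.2 := by unfold dt; ring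
        apply Prod.ext
        · simp only [Prod.smul_fst, smul_eq_mul, Prod.fst_add, ha, hb]
          field_simp; linarith
        · simp only [Prod.smul_snd, smul_eq_mul, Prod.snd_add, ha, hb]
          field_simp; linarith
      have hs : 0 < a + b := by
        rcases (add_nonneg ha0 hb0).lt_or_eq with h1 | h1
        · exact h1
        · exfalso
          have a0 : a = 0 := by linarith
          have b0 : b = 0 := by linarith
          rw [a0, b0, zero_smul, zero_smul, add_zero] at e
          exact ne_zero_of_nm hv e
      refine ⟨(a + b)⁻¹ • v, ?_, ?_⟩
      · refine ⟨a / (a + b), b / (a + b), by positivity, by positivity, by field_simp, ?_⟩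
        conv_rhs => rw [e]
        rw [smul_add, smul_smul, smul_smul]
        congr 2 <;> ring
      · unfold rad
        rw [nm_smul, hv, mul_one, abs_of_pos (inv_pos.2 hs), inv_inv, smul_smul,
          mul_inv_cancel₀ hs.ne', one_smul]
    · rintro _ ⟨v, hv, rfl⟩
      obtain ⟨h1, h2⟩ := hseg v hv
      refine ⟨?_, ?_⟩
      · exact (cone_smul (inv_pos.2 (nm_pos Ψ h2))).2 h1
      · rw [h.frontier_body]; exact nm_rad Ψ h2
  rw [heq]
  apply (convex_segment x y).isPreconnected.image
  intro v hv
  exact (h.contDiffAt_rad (hseg v hv).2).continuousAt.continuousWithinAt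

lemma Dat.arc {W Ψ : ℝ → ℝ} (h : Dat W Ψ) {C : Set Plane} {x y : Plane}
    (hC : IsBArc (body Ψ) C x y) (hd : dt x y ≠ 0) : C = cone x y ∩ frontier (body Ψ) := by
  obtain ⟨hf, hcl, hpc, hxC, hyC, hanti, hmin⟩ := hC
  have hn : ∀ v ∈ C, nm Ψ v = 1 := fun v hv => (h.frontier_body v).1 (hf hv)
  have hd2 : 0 < dt x y * dt x y := mul_self_pos.2 hd
  have c1 : Continuous fun v => dt x y * dt x v := continuous_const.mul (cont_dt x)
  have c2 : Continuous fun v => dt x y * dt v y := continuous_const.mul (cont_dt' y)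
  have step1 : C ⊆ {v | 0 < dt x y * dt x v ∨ 0 < dt x y * dt v y} := by
    apply hpc.subset_left_of_subset_union (v := {v | dt x y * dt x v < 0 ∧ dt x y * dt v y < 0})
    · exact (isOpen_lt continuous_const c1).union (isOpen_lt continuous_const c2)
    · exact (isOpen_lt c1 continuous_const).inter (isOpen_lt c2 continuous_const)
    · rw [Set.disjoint_left]; intro v; simp only [mem_ofPred_eq]; grind
    · intro v hv
      by_contra hcon
      simp only [mem_union, mem_ofPred_eq, not_or, not_and, not_lt] at hcon
      obtain ⟨⟨p1, p2⟩, p3⟩ := hcon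
      by_cases q : dt x v = 0
      · rcases par Ψ (hn x hxC) (hn v hv) q with e | e
        · rw [e] at p2; linarith
        · exact hanti x hxC (e ▸ hv)
      · have q1 : dt x y * dt x v < 0 := lt_of_le_of_ne p1 (mul_ne_zero hd q)
        have q2 : dt v y = 0 := by
          have := le_antisymm p2 (p3 q1)
          exact (mul_eq_zero.1 this).resolve_left hd
        rcases par Ψ (hn v hv) (hn y hyC) q2 with e | e
        · rw [← e] at p1; linarith
        · exact hanti v hv (e ▸ hyC)
    · exact ⟨x, hxC, Or.inr hd2⟩
  have step2 : cone x y ∩ frontier (body Ψ) ⊆ C := by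
    rintro z ⟨⟨z1, z2⟩, hz⟩
    rw [h.frontier_body] at hz
    by_contra hzC
    have hnz : -z ∉ C := by
      intro hc
      have := step1 hc
      simp only [mem_ofPred_eq, dt_neg_right, dt_neg_left, mul_neg] at this
      grind
    have hne : ∀ v ∈ C, dt z v ≠ 0 := by
      intro v hv e
      rcases par Ψ hz (hn v hv) e with e | e
      · exact hzC (e ▸ hv)
      · exact hnz (e ▸ hv)
    have hx0 := hne x hxC
    have hy0 := hne y hyC
    have c3 : Continuous fun v => dt x y * dt z v := continuous_const.mul (cont_dt z)
    have hs : C ⊆ {v | 0 < dt x y * dt z v} := by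
      apply hpc.subset_left_of_subset_union (v := {v | dt x y * dt z v < 0})
      · exact isOpen_lt continuous_const c3
      · exact isOpen_lt c3 continuous_const
      · rw [Set.disjoint_left]; intro v; simp only [mem_ofPred_eq]; grind
      · intro v hv
        exact (lt_or_gt_of_ne (mul_ne_zero hd (hne v hv))).symm
      · exact ⟨y, hyC, lt_of_le_of_ne z2 (mul_ne_zero hd hy0).symm⟩
    have h1 : 0 < dt x y * dt z x := hs hxC
    rw [dt_swap x z, mul_neg] at h1
    linarith
  symm
  refine hmin _ step2 ((cone_closed x y).inter isClosed_frontier) (h.cone_conn hd) ?_ ?_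
  · exact ⟨left_mem_cone x y, hf hxC⟩
  · exact ⟨right_mem_cone x y, hf hyC⟩

lemma Dat.bmeasure {W Ψ : ℝ → ℝ} (h : Dat W Ψ) {ν : Measure Plane} (hν : NuProp W ν) :
    IsBMeasure (body Ψ) (ν.map (rad Ψ)) := by
  have mr := h.measurable_rad
  have mf : MeasurableSet (frontier (body Ψ)) := isClosed_frontier.measurableSet
  have hne : ∀ᵐ v ∂ν, v ≠ 0 := hν.good.mono fun v hv => hv.1
  have hfr : ∀ v : Plane, v ≠ 0 → rad Ψ v ∈ frontier (body Ψ) := fun v hv => by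
    rw [h.frontier_body]; exact nm_rad Ψ hv
  have hneg : (ν.map (rad Ψ)).map (fun v => -v) = ν.map (rad Ψ) := by
    have e0 : ν.map (fun v => -v) = ν := by
      have : (fun v : Plane => -v) = rot ∘ rot := by ext1 v; exact (rot_rot v).symm
      rw [this, ← Measure.map_map measurable_rot measurable_rot, hν.inv, hν.inv]
    have e1 : (fun v : Plane => -v) ∘ rad Ψ = rad Ψ ∘ (fun v => -v) := by
      ext1 v; exact (rad_neg Ψ v).symm
    rw [Measure.map_map measurable_neg mr, e1, ← Measure.map_map mr measurable_neg, e0]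
  refine ⟨⟨?_, ?_, ?_, ?_⟩, ?_⟩
  · rw [Measure.map_apply mr mf, ← hν.tot]
    apply measure_congr
    filter_upwards [hne] with v hv
    exact propext ⟨fun _ => trivial, fun _ => hfr v hv⟩
  · rw [Measure.map_apply mr mf.compl]
    have : ∀ᵐ v ∂ν, rad Ψ v ∈ frontier (body Ψ) := hne.mono hfr
    exact this
  · intro X
    conv_rhs => rw [← hneg]
    exact ((MeasurableEquiv.neg Plane).map_apply X).symm
  · intro x
    rw [Measure.map_apply mr (measurableSet_singleton x)]
    have : ∀ᵐ v ∂ν, rad Ψ v ≠ x := by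
      by_cases hx : x = 0
      · filter_upwards [hne] with v hv e
        have := nm_rad Ψ hv
        exact ne_zero_of_nm this (e.trans hx)
      · filter_upwards [hν.line x hx, hne] with v hv hv0 e
        have e2 : dt x (rad Ψ v) = 0 := by rw [e]; exact dt_self x
        unfold rad at e2
        rw [dt_smul_right] at e2
        exact mul_ne_zero (inv_ne_zero (nm_pos Ψ hv0).ne') hv e2
    have h2 := ae_iff.1 this
    simp only [ne_eq, not_not] at h2
    exact h2
  · intro C x y hC hb
    have hx : nm Ψ x = 1 := (h.frontier_body x).1 (hC.1 hC.2.2.2.1)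
    have hy : nm Ψ y = 1 := (h.frontier_body y).1 (hC.1 hC.2.2.2.2.1)
    have hx0 := ne_zero_of_nm hx
    have hy0 := ne_zero_of_nm hy
    have hb' := (h.borth hx0 y).1 hb
    rw [h.arc hC (h.dt_ne hx0 hy0 hb'), Measure.map_apply mr ((cone_closed x y).measurableSet.inter mf),
      ← h.cone_measure hν hx0 hy0 hb']
    apply measure_congr
    filter_upwards [hne] with v hv
    apply propext
    change (rad Ψ v ∈ cone x y ∧ rad Ψ v ∈ frontier (body Ψ)) ↔ v ∈ cone x y
    have := hfr v hv
    have e := cone_smul (x := x) (y := y) (v := v) (inv_pos.2 (nm_pos Ψ hv))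
    exact ⟨fun a => e.1 a.1, fun a => ⟨e.2 a, this⟩⟩

/-- There is a smooth, strictly convex, origin-symmetric planar body whose
Auerbach set is uncountable of one-dimensional Hausdorff measure zero;
in particular it admits a B-measure although `A(K)` is a null set. -/
theorem stmt_14 :
    ∃ K : Set Plane, IsSymmConvexBody K ∧
      (∀ a ∈ frontier K, ∀ b ∈ frontier K, a ≠ b →
        openSegment ℝ a b ⊆ interior K) ∧
      ContDiffOn ℝ (⊤ : ℕ∞) (gauge K) {(0 : Plane)}ᶜ ∧
      μH[1] (Auerbach K) = 0 ∧
      ¬ (Auerbach K).Countable ∧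
      ∃ μ : Measure Plane, IsBMeasure K μ := by
  obtain ⟨W, Ψ, h⟩ := exists_dat
  obtain ⟨ν, hν⟩ := h.exists_nu
  exact ⟨body Ψ, h.symm_body, h.strict, h.smooth_gauge, h.auerbach_null, h.auerbach_unctbl,
    ν.map (rad Ψ), h.bmeasure hν⟩
end
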